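/- arXiv:1605.01172 — 7 statements merged into one kernel-verified Lean document; each statement's English description precedes it below -/
import Mathlib

section
/- For every dimension d ≥ 3, every real ε > 0, and every integer n ≥ 3, G_d(ε, n) ≤ G_d(ε, n+1). -/
open Real

noncomputable section

/-- Vertex set of a full Steiner topology on `n` terminals:
`n` terminals and `n - 2` Steiner points. -/
abbrev SteinerVert (n : ℕ) := Fin n ⊕ Fin (n - 2)

/-- Euclidean space `ℝ^d`. -/
abbrev Epc (d : ℕ) := EuclideanSpace ℝ (Fin d)

/-- A full Steiner topology on `n` terminals: a tree on `n` terminals and `n - 2`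
Steiner points in which every terminal has degree `1` and every Steiner point has
degree `3`. -/
structure FullSteinerTopology (n : ℕ) where
  graph : SimpleGraph (SteinerVert n)
  isTree : graph.IsTree
  degTerminal : ∀ t : Fin n, (graph.neighborSet (Sum.inl t)).ncard = 1
  degSteiner : ∀ s : Fin (n - 2), (graph.neighborSet (Sum.inr s)).ncard = 3

open Classical in
/-- The total length of the Steiner tree obtained by realizing the topology `G`
via the placement `pos`, i.e. the sum of the Euclidean lengths of its edges. -/
noncomputable def treeLength {n d : ℕ} (G : FullSteinerTopology n)
    (pos : SteinerVert n → Epc d) : ℝ :=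
  (1 / 2) * ∑ u : SteinerVert n, ∑ v : SteinerVert n,
    if G.graph.Adj u v then dist (pos u) (pos v) else 0

/-- The realization `pos` of the topology `G` is a full `ε`-approximate Steiner tree:
at every Steiner point, every angle spanned by two incident edges lies in
`[2π/3 - ε, 2π/3 + ε]`. -/
def IsApproxSteiner {n d : ℕ} (ε : ℝ) (G : FullSteinerTopology n)
    (pos : SteinerVert n → Epc d) : Prop :=
  ∀ s : Fin (n - 2), ∀ u v : SteinerVert n,
    G.graph.Adj (Sum.inr s) u → G.graph.Adj (Sum.inr s) v → u ≠ v →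
      |EuclideanGeometry.angle (pos u) (pos (Sum.inr s)) (pos v) - 2 * π / 3| ≤ ε

/-- A locally minimum Steiner tree: no degenerate edges, and every angle spanned by
two edges at a common vertex is at least `2π/3`. -/
def IsLocallyMinimumTree {n d : ℕ} (G : FullSteinerTopology n)
    (pos : SteinerVert n → Epc d) : Prop :=
  (∀ u v : SteinerVert n, G.graph.Adj u v → pos u ≠ pos v) ∧
  ∀ x u v : SteinerVert n, G.graph.Adj x u → G.graph.Adj x v → u ≠ v →
    2 * π / 3 ≤ EuclideanGeometry.angle (pos u) (pos x) (pos v)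

/-- The length `L(S(T))` of the shortest Steiner tree with the same topology `G` and the
same terminals as the realization `pos` (degenerate edges allowed). -/
noncomputable def minTreeLength {n d : ℕ} (G : FullSteinerTopology n)
    (pos : SteinerVert n → Epc d) : ℝ :=
  sInf { L : ℝ | ∃ pos' : SteinerVert n → Epc d,
    (∀ t : Fin n, pos' (Sum.inl t) = pos (Sum.inl t)) ∧ L = treeLength G pos' }

/-- `F_d(ε, n)`: the supremum of `L(T)/L(S(T)) - 1` over all full `ε`-approximate
Steiner trees `T` on `n` terminals in `ℝ^d`. -/
noncomputable def steinerF (d : ℕ) (ε : ℝ) (n : ℕ) : ℝ :=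
  sSup { r : ℝ | ∃ (G : FullSteinerTopology n) (pos : SteinerVert n → Epc d),
    IsApproxSteiner ε G pos ∧
    r = treeLength G pos / minTreeLength G pos - 1 }

/-- `G_d(ε, n)`: the supremum of `L(T)/L(S(T)) - 1` over all full `ε`-approximate
Steiner trees `T` on `n` terminals in `ℝ^d` such that the shortest tree `S(T)` with the
same terminals and topology is a (non-degenerate) locally minimum Steiner tree. -/
noncomputable def steinerG (d : ℕ) (ε : ℝ) (n : ℕ) : ℝ :=
  sSup { r : ℝ | ∃ (G : FullSteinerTopology n)
    (pos pos' : SteinerVert n → Epc d),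
    IsApproxSteiner ε G pos ∧
    (∀ t : Fin n, pos' (Sum.inl t) = pos (Sum.inl t)) ∧
    treeLength G pos' = minTreeLength G pos ∧
    IsLocallyMinimumTree G pos' ∧
    r = treeLength G pos / minTreeLength G pos - 1 }


namespace SimpleGraph

variable {V : Type*}

/-- The graph obtained from `G` by attaching two new leaves to the vertex `t`. -/
def attachLeaves (G : SimpleGraph V) (t : V) : SimpleGraph (V ⊕ Bool) where
  Adj
    | Sum.inl x, Sum.inl y => G.Adj x y
    | Sum.inl x, Sum.inr _ => x = t
    | Sum.inr _, Sum.inl y => y = t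
    | Sum.inr _, Sum.inr _ => False
  symm := ⟨by
    rintro (x | b) (y | c) h
    · exact SimpleGraph.Adj.symm (G := G) h
    · exact h
    · exact h
    · exact h⟩
  loopless := ⟨by
    rintro (x | b) h
    · exact G.loopless.irrefl x h
    · exact h⟩

section attachLeaves

variable (G : SimpleGraph V) (t : V)

@[simp] lemma attachLeaves_inl_inl (x y : V) :
    (G.attachLeaves t).Adj (Sum.inl x) (Sum.inl y) ↔ G.Adj x y := Iff.rfl

@[simp] lemma attachLeaves_inl_inr (x : V) (b : Bool) :
    (G.attachLeaves t).Adj (Sum.inl x) (Sum.inr b) ↔ x = t := Iff.rfl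

@[simp] lemma attachLeaves_inr_inl (b : Bool) (y : V) :
    (G.attachLeaves t).Adj (Sum.inr b) (Sum.inl y) ↔ y = t := Iff.rfl

@[simp] lemma attachLeaves_inr_inr (b c : Bool) :
    ¬ (G.attachLeaves t).Adj (Sum.inr b) (Sum.inr c) := id

variable {G}

lemma Connected.attachLeaves (hG : G.Connected) : (G.attachLeaves t).Connected := by
  have hinl : ∀ x, (G.attachLeaves t).Reachable (Sum.inl x) (Sum.inl t) := fun x =>
    (hG.preconnected x t).map (G' := G.attachLeaves t) ⟨Sum.inl, fun h => h⟩
  have key : ∀ w, (G.attachLeaves t).Reachable w (Sum.inl t) := by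
    rintro (x | b)
    · exact hinl x
    · exact Adj.reachable (by simp)
  have : Nonempty (V ⊕ Bool) := ⟨Sum.inl t⟩
  exact ⟨fun u v => (key u).trans (key v).symm⟩

lemma ncard_neighborSet_attachLeaves_inr (b : Bool) :
    ((G.attachLeaves t).neighborSet (Sum.inr b)).ncard = 1 := by
  rw [Set.ncard_eq_one]
  refine ⟨Sum.inl t, ?_⟩
  ext (x | c) <;> simp

lemma ncard_neighborSet_attachLeaves_inl {x : V} (hx : x ≠ t) :
    ((G.attachLeaves t).neighborSet (Sum.inl x)).ncard = (G.neighborSet x).ncard := by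
  rw [← Set.ncard_image_of_injective _ (Sum.inl_injective (α := V) (β := Bool))]
  congr 1
  ext (y | c) <;> simp [hx]

lemma ncard_neighborSet_attachLeaves_self (ht : (G.neighborSet t).ncard = 1) :
    ((G.attachLeaves t).neighborSet (Sum.inl t)).ncard = 3 := by
  obtain ⟨s, hs⟩ := Set.ncard_eq_one.1 ht
  rw [Set.ncard_eq_three]
  refine ⟨Sum.inl s, Sum.inr true, Sum.inr false, by simp, by simp, by simp, ?_⟩
  ext (y | c)
  · have := Set.ext_iff.1 hs y
    simpa using this
  · cases c <;> simp

end attachLeaves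

/-- In a tree, a vertex has at most one neighbour that is not further from a given root. -/
lemma IsTree.eq_of_adj_of_dist_le {G : SimpleGraph V} (hG : G.IsTree) {r x u v : V}
    (hu : G.Adj x u) (hv : G.Adj x v) (hdu : G.dist r u ≤ G.dist r x)
    (hdv : G.dist r v ≤ G.dist r x) : u = v := by
  have key : ∀ y, G.Adj x y → G.dist r y ≤ G.dist r x →
      ∃ p : G.Walk r x, p.IsPath ∧ p.penultimate = y := by
    intro y hy hd
    obtain ⟨p, hp⟩ := hG.connected.exists_walk_length_eq_dist r y
    refine ⟨p.concat hy.symm, Walk.isPath_of_length_eq_dist _ ?_, p.penultimate_concat hy.symm⟩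
    rw [Walk.length_concat, hp]
    have := hG.dist_eq_dist_add_one_of_adj r hy
    omega
  obtain ⟨p, hp, rfl⟩ := key u hu hdu
  obtain ⟨q, hq, rfl⟩ := key v hv hdv
  have := hG.isAcyclic.subsingleton_path r x
  have hpq : p = q := congrArg Subtype.val (Subsingleton.elim (⟨p, hp⟩ : G.Path r x) ⟨q, hq⟩)
  rw [hpq]

end SimpleGraph

/-- A connected graph with the degrees of a full Steiner topology is a tree. -/
lemma isTree_of_connected_of_degrees {n : ℕ} (hn : 2 ≤ n) (G : SimpleGraph (SteinerVert n))
    (hG : G.Connected) (h₁ : ∀ t : Fin n, (G.neighborSet (Sum.inl t)).ncard = 1)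
    (h₃ : ∀ s : Fin (n - 2), (G.neighborSet (Sum.inr s)).ncard = 3) : G.IsTree := by
  classical
  refine SimpleGraph.isTree_iff_connected_and_card.2 ⟨hG, ?_⟩
  have hdeg := G.sum_degrees_eq_twice_card_edges
  have hd : ∀ v, G.degree v = (G.neighborSet v).ncard := fun v => by
    rw [← G.card_neighborSet_eq_degree, Set.ncard_eq_toFinset_card', Set.toFinset_card]
  simp only [hd, Fintype.sum_sum_type, h₁, h₃] at hdeg
  rw [Nat.card_eq_fintype_card, Nat.card_eq_fintype_card, ← SimpleGraph.edgeFinset_card]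
  simp at hdeg ⊢
  omega

/-- The vertices of a full Steiner topology on `n + 1` terminals, seen as those of a topology on
`n` terminals, with the terminal `t` turned into a Steiner point, and two new terminals. -/
def splitVert {n : ℕ} (hn : 2 ≤ n) (t : Fin n) :
    SteinerVert (n + 1) → SteinerVert n ⊕ Bool
  | Sum.inl i => Fin.cases (Sum.inr false)
      (fun j => if j = t then Sum.inr true else Sum.inl (Sum.inl j)) i
  | Sum.inr j => Fin.cases (Sum.inl (Sum.inl t)) (fun k => Sum.inl (Sum.inr k))
      (Fin.cast (by omega : n + 1 - 2 = n - 2 + 1) j)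

lemma splitVert_inl {n : ℕ} (hn : 2 ≤ n) (t : Fin n) (i : Fin (n + 1)) :
    (∃ b, splitVert hn t (Sum.inl i) = Sum.inr b) ∨
      ∃ j, j ≠ t ∧ splitVert hn t (Sum.inl i) = Sum.inl (Sum.inl j) := by
  refine Fin.cases ?_ (fun j => ?_) i
  · exact Or.inl ⟨false, rfl⟩
  · by_cases hj : j = t
    · exact Or.inl ⟨true, by simp [splitVert, hj]⟩
    · exact Or.inr ⟨j, hj, by simp [splitVert, hj]⟩

lemma splitVert_inr {n : ℕ} (hn : 2 ≤ n) (t : Fin n) (i : Fin (n + 1 - 2)) :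
    splitVert hn t (Sum.inr i) = Sum.inl (Sum.inl t) ∨
      ∃ k, splitVert hn t (Sum.inr i) = Sum.inl (Sum.inr k) := by
  simp only [splitVert]
  refine Fin.cases ?_ (fun j => ?_) (Fin.cast (by omega : n + 1 - 2 = n - 2 + 1) i)
  · exact Or.inl rfl
  · exact Or.inr ⟨j, rfl⟩

lemma splitVert_bijective {n : ℕ} (hn : 2 ≤ n) (t : Fin n) :
    Function.Bijective (splitVert hn t) := by
  rw [Fintype.bijective_iff_injective_and_card]
  refine ⟨?_, by simp; omega⟩
  have hl : ∀ i i', splitVert hn t (Sum.inl i) = splitVert hn t (Sum.inl i') → i = i' := by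
    intro i i'
    refine Fin.cases ?_ (fun j => ?_) i <;> refine Fin.cases ?_ (fun j' => ?_) i' <;>
      simp only [splitVert, Fin.cases_zero, Fin.cases_succ] <;> (try split_ifs) <;> simp_all
  have hr : ∀ i i', splitVert hn t (Sum.inr i) = splitVert hn t (Sum.inr i') → i = i' := by
    intro i i' h
    rw [← Fin.cast_inj (by omega : n + 1 - 2 = n - 2 + 1)]
    simp only [splitVert] at h
    generalize Fin.cast (by omega : n + 1 - 2 = n - 2 + 1) i = a at *
    generalize Fin.cast (by omega : n + 1 - 2 = n - 2 + 1) i' = b at *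
    induction a using Fin.cases <;> induction b using Fin.cases <;> simp_all
  have hlr : ∀ i i', splitVert hn t (Sum.inl i) ≠ splitVert hn t (Sum.inr i') := by
    intro i i' h
    rcases splitVert_inl hn t i with ⟨b, hb⟩ | ⟨j, hj, hb⟩ <;>
      rcases splitVert_inr hn t i' with hc | ⟨k, hc⟩ <;> simp_all
  rintro (i | i) (j | j) h
  · rw [hl i j h]
  · exact absurd h (hlr i j)
  · exact absurd h.symm (hlr j i)
  · rw [hr i j h]

/-- Attaching two terminals to a terminal of a full Steiner topology yields such a topology. -/
lemma FullSteinerTopology.exists_attachLeaves {n : ℕ} (hn : 2 ≤ n) (G : FullSteinerTopology n)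
    (t : Fin n) :
    ∃ (G' : FullSteinerTopology (n + 1)) (e : SteinerVert (n + 1) ≃ SteinerVert n ⊕ Bool),
      (∀ x y, G'.graph.Adj x y ↔ (G.graph.attachLeaves (Sum.inl t)).Adj (e x) (e y)) ∧
      (∀ i, (∃ b, e (Sum.inl i) = Sum.inr b) ∨
        ∃ j, j ≠ t ∧ e (Sum.inl i) = Sum.inl (Sum.inl j)) ∧
      (∀ i, e (Sum.inr i) = Sum.inl (Sum.inl t) ∨ ∃ k, e (Sum.inr i) = Sum.inl (Sum.inr k)) := by
  set e := Equiv.ofBijective _ (splitVert_bijective hn t) with he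
  have hl : ∀ i, (∃ b, e (Sum.inl i) = Sum.inr b) ∨
        ∃ j, j ≠ t ∧ e (Sum.inl i) = Sum.inl (Sum.inl j) := splitVert_inl hn t
  have hr : ∀ i, e (Sum.inr i) = Sum.inl (Sum.inl t) ∨
      ∃ k, e (Sum.inr i) = Sum.inl (Sum.inr k) := splitVert_inr hn t
  set H := G.graph.attachLeaves (Sum.inl t) with hH
  have hconn : (H.comap e).Connected :=
    (SimpleGraph.Iso.comap e H).connected_iff.2 (G.isTree.connected.attachLeaves _)
  have hdeg : ∀ x, ((H.comap e).neighborSet x).ncard = (H.neighborSet (e x)).ncard := fun x =>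
    Set.ncard_preimage_of_injective_subset_range (s := H.neighborSet (e x)) e.injective
      (by simp [e.surjective.range_eq])
  have h₁ : ∀ i, ((H.comap e).neighborSet (Sum.inl i)).ncard = 1 := by
    intro i
    rw [hdeg]
    rcases hl i with ⟨b, hb⟩ | ⟨j, hj, hb⟩ <;> rw [hb]
    · exact SimpleGraph.ncard_neighborSet_attachLeaves_inr _ b
    · rw [SimpleGraph.ncard_neighborSet_attachLeaves_inl _ (by simpa using hj)]
      exact G.degTerminal j
  have h₃ : ∀ i, ((H.comap e).neighborSet (Sum.inr i)).ncard = 3 := by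
    intro i
    rw [hdeg]
    rcases hr i with hb | ⟨j, hb⟩ <;> rw [hb]
    · exact SimpleGraph.ncard_neighborSet_attachLeaves_self _ (G.degTerminal t)
    · rw [SimpleGraph.ncard_neighborSet_attachLeaves_inl _ (by simp)]
      exact G.degSteiner j
  exact ⟨⟨H.comap e, isTree_of_connected_of_degrees (by omega) _ hconn h₁ h₃, h₁, h₃⟩, e,
    fun _ _ => Iff.rfl, hl, hr⟩

section TreeLength

variable {n d : ℕ}

lemma treeLength_nonneg (G : FullSteinerTopology n) (pos : SteinerVert n → Epc d) :
    0 ≤ treeLength G pos := by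
  unfold treeLength
  refine mul_nonneg (by norm_num) (Finset.sum_nonneg fun u _ => Finset.sum_nonneg fun v _ => ?_)
  split_ifs
  · exact dist_nonneg
  · exact le_rfl

lemma dist_le_two_mul_treeLength (G : FullSteinerTopology n) (pos : SteinerVert n → Epc d)
    {u v : SteinerVert n} (h : G.graph.Adj u v) :
    dist (pos u) (pos v) ≤ 2 * treeLength G pos := by
  classical
  have h0 : ∀ u v : SteinerVert n,
      0 ≤ if G.graph.Adj u v then dist (pos u) (pos v) else 0 := by
    intro u v
    split_ifs
    · exact dist_nonneg
    · exact le_rfl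
  have h1 := Finset.single_le_sum
    (f := fun v => if G.graph.Adj u v then dist (pos u) (pos v) else 0)
    (fun v _ => h0 u v) (Finset.mem_univ v)
  have h2 := Finset.single_le_sum
    (f := fun u => ∑ v, if G.graph.Adj u v then dist (pos u) (pos v) else 0)
    (fun u _ => Finset.sum_nonneg fun v _ => h0 u v) (Finset.mem_univ u)
  simp only [h, if_true] at h1
  unfold treeLength
  refine (h1.trans h2).trans (le_of_eq ?_)
  simp only [← mul_assoc]
  norm_num

lemma dist_le_length_mul_treeLength (G : FullSteinerTopology n) (pos : SteinerVert n → Epc d)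
    {u v : SteinerVert n} (p : G.graph.Walk u v) :
    dist (pos u) (pos v) ≤ p.length * (2 * treeLength G pos) := by
  induction p with
  | nil => simp
  | cons h p ih =>
    have := dist_le_two_mul_treeLength G pos h
    rw [SimpleGraph.Walk.length_cons]
    push_cast
    linarith [dist_triangle (pos _) (pos _) (pos _) |>.trans (add_le_add this ih)]

/-- Any two vertices of a realized tree are at distance at most a multiple of its length. -/
lemma dist_le_card_mul_treeLength (G : FullSteinerTopology n) (pos : SteinerVert n → Epc d)
    (u v : SteinerVert n) :
    dist (pos u) (pos v) ≤ Fintype.card (SteinerVert n) * (2 * treeLength G pos) := by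
  obtain ⟨p, hp, -⟩ := G.isTree.connected.exists_path_of_dist u v
  refine (dist_le_length_mul_treeLength G pos p).trans ?_
  have := treeLength_nonneg G pos
  gcongr
  exact hp.length_lt.le

lemma treeLength_le_of_dist_le (G : FullSteinerTopology n) (pos : SteinerVert n → Epc d) {D : ℝ}
    (hD : 0 ≤ D) (h : ∀ u v, dist (pos u) (pos v) ≤ D) :
    treeLength G pos ≤ (Fintype.card (SteinerVert n)) ^ 2 * D := by
  classical
  unfold treeLength
  have : ∑ u : SteinerVert n, ∑ v : SteinerVert n,
      (if G.graph.Adj u v then dist (pos u) (pos v) else 0) ≤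
      ∑ u : SteinerVert n, ∑ v : SteinerVert n, D :=
    Finset.sum_le_sum fun u _ => Finset.sum_le_sum fun v _ => by
      split_ifs
      · exact h u v
      · exact hD
  have h0 : (0 : ℝ) ≤ (Fintype.card (SteinerVert n)) ^ 2 * D := by positivity
  simp only [Finset.sum_const, Finset.card_univ, nsmul_eq_mul] at this
  rw [← mul_assoc, ← sq] at this
  linarith

lemma treeLength_attachLeaves {n' : ℕ} {G : FullSteinerTopology n} {t : SteinerVert n}
    {G' : FullSteinerTopology n'} {e : SteinerVert n' ≃ SteinerVert n ⊕ Bool}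
    (hG' : ∀ x y, G'.graph.Adj x y ↔ (G.graph.attachLeaves t).Adj (e x) (e y))
    (pos : SteinerVert n → Epc d) :
    treeLength G' (fun x => Sum.elim pos (fun _ => pos t) (e x)) = treeLength G pos := by
  classical
  unfold treeLength
  congr 1
  simp only [hG']
  rw [e.sum_comp (fun w => ∑ v, if (G.graph.attachLeaves t).Adj w (e v) then
    dist (Sum.elim pos (fun _ => pos t) w) (Sum.elim pos (fun _ => pos t) (e v)) else 0)]
  have : ∀ w, (∑ v, if (G.graph.attachLeaves t).Adj w (e v) then
    dist (Sum.elim pos (fun _ => pos t) w) (Sum.elim pos (fun _ => pos t) (e v)) else 0) =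
    ∑ v, if (G.graph.attachLeaves t).Adj w v then
    dist (Sum.elim pos (fun _ => pos t) w) (Sum.elim pos (fun _ => pos t) v) else 0 := fun w =>
    e.sum_comp (fun v => if (G.graph.attachLeaves t).Adj w v then
    dist (Sum.elim pos (fun _ => pos t) w) (Sum.elim pos (fun _ => pos t) v) else 0)
  simp only [this]
  rw [Fintype.sum_sum_type]
  simp only [Fintype.sum_sum_type (α₁ := SteinerVert n) (α₂ := Bool)]
  have h1 : ∀ x : SteinerVert n, (if x = t then dist (pos x) (pos t) else 0) = 0 := by
    intro x
    split_ifs with h <;> simp [h]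
  have h2 : ∀ x : SteinerVert n, (if x = t then dist (pos t) (pos x) else 0) = 0 := by
    intro x
    split_ifs with h <;> simp [h]
  simp [h1, h2]

lemma continuous_treeLength (G : FullSteinerTopology n) {X : Type*} [TopologicalSpace X]
    {pos : X → SteinerVert n → Epc d} (h : ∀ v, Continuous fun x => pos x v) :
    Continuous fun x => treeLength G (pos x) := by
  unfold treeLength
  refine continuous_const.mul (continuous_finsetSum _ fun u _ =>
    continuous_finsetSum _ fun v _ => ?_)
  split_ifs
  · exact (h u).dist (h v)
  · exact continuous_const

end TreeLength

section Minimality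

variable {n d : ℕ}

lemma inner_le_neg_half_of_angle {V : Type*} [NormedAddCommGroup V] [InnerProductSpace ℝ V]
    {x y : V} (hx : ‖x‖ = 1) (hy : ‖y‖ = 1) (h : 2 * π / 3 ≤ InnerProductGeometry.angle x y) :
    inner ℝ x y ≤ -(1 / 2) := by
  have h1 : inner ℝ x y = Real.cos (InnerProductGeometry.angle x y) := by
    rw [InnerProductGeometry.cos_angle, hx, hy]; simp
  rw [h1]
  have h2 : Real.cos (2 * π / 3) = -(1 / 2) := by
    rw [show 2 * π / 3 = π - π / 3 by ring, Real.cos_pi_sub, Real.cos_pi_div_three]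
  rw [← h2]
  exact Real.cos_le_cos_of_nonneg_of_le_pi (by positivity)
    (InnerProductGeometry.angle_le_pi x y) h

/-- Three unit vectors that pairwise span angles of at least `2π/3` sum to zero. -/
lemma add_add_eq_zero_of_angle {V : Type*} [NormedAddCommGroup V] [InnerProductSpace ℝ V]
    {x y z : V} (hx : ‖x‖ = 1) (hy : ‖y‖ = 1) (hz : ‖z‖ = 1)
    (hxy : 2 * π / 3 ≤ InnerProductGeometry.angle x y)
    (hxz : 2 * π / 3 ≤ InnerProductGeometry.angle x z)
    (hyz : 2 * π / 3 ≤ InnerProductGeometry.angle y z) : x + y + z = 0 := by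
  have h1 := inner_le_neg_half_of_angle hx hy hxy
  have h2 := inner_le_neg_half_of_angle hx hz hxz
  have h3 := inner_le_neg_half_of_angle hy hz hyz
  have h4 : ‖x + y + z‖ ^ 2 ≤ 0 := by
    rw [norm_add_sq_real, norm_add_sq_real, inner_add_left, hx, hy, hz]
    linarith
  exact norm_eq_zero.1 (pow_eq_zero_iff (two_ne_zero) |>.1 (le_antisymm h4 (sq_nonneg _)))

open Classical in
/-- At a Steiner point of a locally minimum tree, the unit vectors along the edges sum to zero. -/
lemma IsLocallyMinimumTree.sum_unit_eq_zero {G : FullSteinerTopology n}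
    {pos : SteinerVert n → Epc d} (h : IsLocallyMinimumTree G pos) (s : Fin (n - 2)) :
    ∑ v, (if G.graph.Adj (Sum.inr s) v then
      ‖pos v - pos (Sum.inr s)‖⁻¹ • (pos v - pos (Sum.inr s)) else 0) = 0 := by
  obtain ⟨x, y, z, hxy, hxz, hyz, hN⟩ := Set.ncard_eq_three.1 (G.degSteiner s)
  have hadj : ∀ v, G.graph.Adj (Sum.inr s) v ↔ v ∈ ({x, y, z} : Finset (SteinerVert n)) := by
    intro v
    have := Set.ext_iff.1 hN v
    simpa using this
  have hpos : ∀ v, G.graph.Adj (Sum.inr s) v → 0 < ‖pos v - pos (Sum.inr s)‖ := fun v hv =>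
    norm_pos_iff.2 (sub_ne_zero.2 (h.1 _ _ hv).symm)
  have hang : ∀ u v, G.graph.Adj (Sum.inr s) u → G.graph.Adj (Sum.inr s) v → u ≠ v →
      2 * π / 3 ≤ InnerProductGeometry.angle
        (‖pos u - pos (Sum.inr s)‖⁻¹ • (pos u - pos (Sum.inr s)))
        (‖pos v - pos (Sum.inr s)‖⁻¹ • (pos v - pos (Sum.inr s))) := by
    intro u v hu hv huv
    rw [InnerProductGeometry.angle_smul_left_of_pos _ _ (inv_pos.2 (hpos u hu)),
      InnerProductGeometry.angle_smul_right_of_pos _ _ (inv_pos.2 (hpos v hv))]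
    exact h.2 _ u v hu hv huv
  have hnorm : ∀ v, G.graph.Adj (Sum.inr s) v →
      ‖‖pos v - pos (Sum.inr s)‖⁻¹ • (pos v - pos (Sum.inr s))‖ = 1 := by
    intro v hv
    rw [norm_smul, norm_inv, norm_norm, inv_mul_cancel₀ (hpos v hv).ne']
  have hx := (hadj x).2 (by simp)
  have hy := (hadj y).2 (by simp)
  have hz := (hadj z).2 (by simp)
  simp only [hadj]
  rw [Finset.sum_ite_mem, Finset.univ_inter, Finset.sum_insert (by simp [hxy, hxz]),
    Finset.sum_pair hyz, ← add_assoc]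
  exact add_add_eq_zero_of_angle (hnorm x hx) (hnorm y hy) (hnorm z hz) (hang x y hx hy hxy)
    (hang x z hx hz hxz) (hang y z hy hz hyz)

open Classical in
/-- A locally minimum tree is shortest among the trees with its topology and terminals. -/
lemma IsLocallyMinimumTree.treeLength_le {G : FullSteinerTopology n}
    {pos pos' : SteinerVert n → Epc d} (h : IsLocallyMinimumTree G pos)
    (ht : ∀ t : Fin n, pos' (Sum.inl t) = pos (Sum.inl t)) :
    treeLength G pos ≤ treeLength G pos' := by
  set f : SteinerVert n → SteinerVert n → Epc d := fun u v =>
    if G.graph.Adj u v then ‖pos v - pos u‖⁻¹ • (pos v - pos u) else 0 with hf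
  set D : SteinerVert n → Epc d := fun v => pos' v - pos v with hD
  have hanti : ∀ u v, f u v = - f v u := by
    intro u v
    simp only [hf, G.graph.adj_comm v u]
    split_ifs
    · rw [norm_sub_rev, ← smul_neg, neg_sub]
    · simp
  have hzero : ∀ u, inner ℝ (∑ v, f u v) (D u) = 0 := by
    rintro (t | s)
    · simp [hD, ht t]
    · rw [hf]
      simp only
      rw [h.sum_unit_eq_zero s, inner_zero_left]
  have hle : ∀ u v, (if G.graph.Adj u v then dist (pos u) (pos v) else 0) +
      inner ℝ (f u v) (D v - D u) ≤ if G.graph.Adj u v then dist (pos' u) (pos' v) else 0 := by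
    intro u v
    simp only [hf]
    split_ifs with huv
    · have hp : 0 < ‖pos v - pos u‖ := norm_pos_iff.2 (sub_ne_zero.2 (h.1 _ _ huv).symm)
      set g := ‖pos v - pos u‖⁻¹ • (pos v - pos u) with hg
      have hgn : ‖g‖ = 1 := by
        rw [hg, norm_smul, norm_inv, norm_norm, inv_mul_cancel₀ hp.ne']
      have h1 : inner ℝ g (pos v - pos u) = dist (pos u) (pos v) := by
        rw [dist_comm, dist_eq_norm, hg, real_inner_smul_left, real_inner_self_eq_norm_sq]
        field_simp
      have h2 : inner ℝ g (pos' v - pos' u) ≤ dist (pos' u) (pos' v) := by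
        rw [dist_comm, dist_eq_norm]
        simpa [hgn] using real_inner_le_norm g (pos' v - pos' u)
      have h3 : D v - D u = (pos' v - pos' u) - (pos v - pos u) := by
        simp only [hD]; abel
      rw [h3, inner_sub_right, h1]
      linarith
    · simp
  have hsum : ∑ u, ∑ v, inner ℝ (f u v) (D v - D u) = 0 := by
    simp only [inner_sub_right, Finset.sum_sub_distrib]
    rw [Finset.sum_comm]
    simp only [← sum_inner, hzero, Finset.sum_const_zero, sub_zero]
    refine Finset.sum_eq_zero fun v _ => ?_
    have : ∑ u, f u v = - ∑ u, f v u := by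
      rw [← Finset.sum_neg_distrib]
      exact Finset.sum_congr rfl fun u _ => hanti u v
    rw [this, inner_neg_left, hzero, neg_zero]
  have := Finset.sum_le_sum fun u (_ : u ∈ Finset.univ) =>
    Finset.sum_le_sum fun v (_ : v ∈ Finset.univ) => hle u v
  simp only [Finset.sum_add_distrib] at this
  rw [hsum] at this
  unfold treeLength
  linarith

lemma IsLocallyMinimumTree.minTreeLength_eq {G : FullSteinerTopology n}
    {pos pos' : SteinerVert n → Epc d} (h : IsLocallyMinimumTree G pos')
    (ht : ∀ t : Fin n, pos' (Sum.inl t) = pos (Sum.inl t)) :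
    minTreeLength G pos = treeLength G pos' := by
  refine IsLeast.csInf_eq ⟨⟨pos', ht, rfl⟩, ?_⟩
  rintro _ ⟨q, hq, rfl⟩
  exact h.treeLength_le fun t => (hq t).trans (ht t).symm

lemma IsLocallyMinimumTree.treeLength_pos (hn : 3 ≤ n) {G : FullSteinerTopology n}
    {pos : SteinerVert n → Epc d} (h : IsLocallyMinimumTree G pos) : 0 < treeLength G pos := by
  obtain ⟨v, hv⟩ := Set.ncard_eq_one.1 (G.degTerminal ⟨0, by omega⟩)
  have hadj : G.graph.Adj (Sum.inl ⟨0, by omega⟩) v := by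
    have := (Set.ext_iff.1 hv v).2 rfl
    exact this
  have := dist_le_two_mul_treeLength G pos hadj
  have := dist_pos.2 (h.1 _ _ hadj)
  linarith

end Minimality

section Ratios

variable {n d : ℕ} {ε : ℝ}

/-- The set of relative errors of which `steinerG` is the supremum. -/
def steinerRatios (d : ℕ) (ε : ℝ) (n : ℕ) : Set ℝ :=
  { r : ℝ | ∃ (G : FullSteinerTopology n)
    (pos pos' : SteinerVert n → Epc d),
    IsApproxSteiner ε G pos ∧
    (∀ t : Fin n, pos' (Sum.inl t) = pos (Sum.inl t)) ∧
    treeLength G pos' = minTreeLength G pos ∧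
    IsLocallyMinimumTree G pos' ∧
    r = treeLength G pos / minTreeLength G pos - 1 }

lemma steinerRatios_nonneg (hn : 3 ≤ n) {r : ℝ} (hr : r ∈ steinerRatios d ε n) : 0 ≤ r := by
  obtain ⟨G, pos, pos', -, ht, hmin, hloc, rfl⟩ := hr
  rw [← hmin, sub_nonneg, one_le_div (hloc.treeLength_pos hn)]
  exact hloc.treeLength_le fun t => (ht t).symm

/-- If every angle is allowed, moving one Steiner point away makes the ratio unbounded. -/
lemma not_bddAbove_steinerRatios (hd : 1 ≤ d) (hn : 3 ≤ n) (hε : 2 * π / 3 ≤ ε)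
    (hne : (steinerRatios d ε n).Nonempty) : ¬ BddAbove (steinerRatios d ε n) := by
  rintro ⟨M, hM⟩
  obtain ⟨_, G, pos, pos', -, ht, hmin, hloc, -⟩ := hne
  set s : SteinerVert n := Sum.inr ⟨0, by omega⟩ with hs
  obtain ⟨v, _, _, -, -, -, hv⟩ := Set.ncard_eq_three.1 (G.degSteiner ⟨0, by omega⟩)
  have hadj : G.graph.Adj s v := by
    have := (Set.ext_iff.1 hv v).2 (by simp)
    exact this
  have hL := hloc.treeLength_pos hn
  have : Nonempty (Fin d) := ⟨⟨0, hd⟩⟩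
  obtain ⟨x, hx⟩ := exists_norm_eq (Epc d)
    (show 0 ≤ 2 * (|M + 1| + 1) * treeLength G pos' by positivity)
  set q : SteinerVert n → Epc d := Function.update pos' s (pos' v + x) with hq
  have hqt : ∀ t : Fin n, pos' (Sum.inl t) = q (Sum.inl t) := fun t => by simp [hq, hs]
  have hmem : treeLength G q / minTreeLength G q - 1 ∈ steinerRatios d ε n := by
    refine ⟨G, q, pos', ?_, hqt, (hloc.minTreeLength_eq hqt).symm, hloc, rfl⟩
    intro s u v _ _ _
    have h1 := EuclideanGeometry.angle_nonneg (q u) (q (Sum.inr s)) (q v)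
    have h2 := EuclideanGeometry.angle_le_pi (q u) (q (Sum.inr s)) (q v)
    rw [abs_le]
    constructor <;> linarith [Real.pi_pos]
  have h1 := hM hmem
  rw [hloc.minTreeLength_eq hqt, sub_le_iff_le_add, div_le_iff₀ hL] at h1
  have h2 := dist_le_two_mul_treeLength G q hadj
  have h3 : dist (q s) (q v) = 2 * (|M + 1| + 1) * treeLength G pos' := by
    rw [hq, Function.update_self, Function.update_of_ne hadj.ne.symm, dist_eq_norm,
      add_sub_cancel_left, hx]
  rw [h3] at h2
  nlinarith [le_abs_self (M + 1)]

/-- A point that sees a segment under an angle bounded away from zero is close to it. -/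
lemma dist_le_of_le_angle {V P : Type*} [NormedAddCommGroup V] [InnerProductSpace ℝ V]
    [MetricSpace P] [NormedAddTorsor V P] {c : ℝ} (hc : 0 < c) (hc' : c < π) {x y z : P}
    (h : c ≤ EuclideanGeometry.angle x y z) : dist x y ≤ (Real.sin c)⁻¹ * dist x z := by
  have hs := Real.sin_pos_of_pos_of_lt_pi hc hc'
  rw [inv_mul_eq_div, le_div_iff₀ hs]
  have hcos : Real.cos (EuclideanGeometry.angle x y z) ≤ Real.cos c :=
    Real.cos_le_cos_of_nonneg_of_le_pi hc.le (EuclideanGeometry.angle_le_pi _ _ _) h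
  have hlaw := EuclideanGeometry.law_cos x y z
  have hab : 0 ≤ dist x y * dist z y := by positivity
  refine abs_le_of_sq_le_sq' ?_ dist_nonneg |>.2
  have h1 := Real.sin_sq_add_cos_sq c
  have h2 := mul_le_mul_of_nonneg_left hcos hab
  have h3 := sq_nonneg (dist z y - dist x y * Real.cos c)
  have h4 : (dist x y * Real.sin c) ^ 2 = dist x y ^ 2 - dist x y ^ 2 * Real.cos c ^ 2 := by
    rw [mul_pow, eq_sub_of_add_eq h1]; ring
  nlinarith

lemma IsApproxSteiner.dist_le {G : FullSteinerTopology n} {pos : SteinerVert n → Epc d}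
    (hε : 0 < ε) (hε' : ε < 2 * π / 3) (h : IsApproxSteiner ε G pos) {r : SteinerVert n} {D : ℝ}
    (hD : 0 ≤ D) (hr : ∀ t : Fin n, dist (pos (Sum.inl t)) (pos r) ≤ D) (j : ℕ)
    (x : SteinerVert n) (hx : Fintype.card (SteinerVert n) ≤ G.graph.dist r x + j) :
    dist (pos x) (pos r) ≤ (1 + 2 * (Real.sin (2 * π / 3 - ε))⁻¹) ^ j * D := by
  set c := 2 * π / 3 - ε with hc
  have hc0 : 0 < c := by linarith
  have hcpi : c < π := by linarith [Real.pi_pos]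
  have hs := Real.sin_pos_of_pos_of_lt_pi hc0 hcpi
  set K := 1 + 2 * (Real.sin c)⁻¹ with hK
  have hK1 : 1 ≤ K := by
    have : 0 < (Real.sin c)⁻¹ := inv_pos.2 hs
    linarith
  induction j generalizing x with
  | zero =>
    obtain ⟨p, hp, hl⟩ := G.isTree.connected.exists_path_of_dist r x
    have := hp.length_lt
    omega
  | succ j ih =>
    rcases x with t | s
    · exact (hr t).trans (le_mul_of_one_le_left hD (one_le_pow₀ hK1))
    · have hfar : ∃ u v, G.graph.Adj (Sum.inr s) u ∧ G.graph.Adj (Sum.inr s) v ∧ u ≠ v ∧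
          G.graph.dist r (Sum.inr s) < G.graph.dist r u ∧
          G.graph.dist r (Sum.inr s) < G.graph.dist r v := by
        obtain ⟨a, b, e, hab, hae, hbe, hN⟩ := Set.ncard_eq_three.1 (G.degSteiner s)
        have hadj : ∀ v, G.graph.Adj (Sum.inr s) v ↔ v = a ∨ v = b ∨ v = e := by
          intro v
          have := Set.ext_iff.1 hN v
          simpa using this
        have ha := (hadj a).2 (by simp)
        have hb := (hadj b).2 (by simp)
        have he := (hadj e).2 (by simp)
        by_contra! hcon
        have h1 := hcon a b ha hb hab
        have h2 := hcon a e ha he hae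
        have h3 := hcon b e hb he hbe
        have g1 := fun h h' => hab (G.isTree.eq_of_adj_of_dist_le (r := r) ha hb h h')
        have g2 := fun h h' => hae (G.isTree.eq_of_adj_of_dist_le (r := r) ha he h h')
        have g3 := fun h h' => hbe (G.isTree.eq_of_adj_of_dist_le (r := r) hb he h h')
        by_cases k1 : G.graph.dist r a ≤ G.graph.dist r (Sum.inr s)
        · exact g3 (not_lt.1 fun k2 => g2 k1 (h3 k2)) (not_lt.1 fun k3 =>
            g1 k1 (not_lt.1 fun k2 => (h3 k2).not_gt k3))
        · exact g3 (h1 (not_le.1 k1)) (h2 (not_le.1 k1))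
      obtain ⟨u, v, hu, hv, huv, hdu, hdv⟩ := hfar
      have iu := ih u (by omega)
      have iv := ih v (by omega)
      have hang := (abs_le.1 (h s u v hu hv huv)).1
      have h1 := dist_le_of_le_angle hc0 hcpi
        (show c ≤ EuclideanGeometry.angle (pos u) (pos (Sum.inr s)) (pos v) by linarith)
      have h2 : dist (pos u) (pos v) ≤ 2 * (K ^ j * D) := by
        linarith [dist_triangle_right (pos u) (pos v) (pos r)]
      calc dist (pos (Sum.inr s)) (pos r)
          ≤ dist (pos u) (pos (Sum.inr s)) + dist (pos u) (pos r) :=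
            dist_triangle_left _ _ _
        _ ≤ (Real.sin c)⁻¹ * (2 * (K ^ j * D)) + K ^ j * D := by gcongr; exact h1.trans (by gcongr)
        _ = K ^ (j + 1) * D := by rw [hK]; ring

lemma bddAbove_steinerRatios (hn : 1 ≤ n) (hε : 0 < ε) (hε' : ε < 2 * π / 3) :
    BddAbove (steinerRatios d ε n) := by
  set N : ℕ := Fintype.card (SteinerVert n) with hN
  set K := 1 + 2 * (Real.sin (2 * π / 3 - ε))⁻¹ with hK
  have hK0 : 0 ≤ K := by
    have := Real.sin_pos_of_pos_of_lt_pi (show 0 < 2 * π / 3 - ε by linarith)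
      (by linarith [Real.pi_pos])
    positivity
  refine ⟨(N : ℝ) ^ 2 * (2 * (K ^ N * (N * 2))), ?_⟩
  rintro _ ⟨G, pos, pos', happ, ht, hmin, hloc, rfl⟩
  rw [← hmin]
  have hL := treeLength_nonneg G pos'
  set L := treeLength G pos'
  set r : SteinerVert n := Sum.inl ⟨0, hn⟩ with hr
  have hterm : ∀ t : Fin n, dist (pos (Sum.inl t)) (pos r) ≤ N * (2 * L) := fun t => by
    rw [hr, ← ht, ← ht]
    exact dist_le_card_mul_treeLength G pos' _ _
  have hall : ∀ x, dist (pos x) (pos r) ≤ K ^ N * (N * (2 * L)) := fun x =>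
    happ.dist_le hε hε' (by positivity) hterm N x (by omega)
  have htree := treeLength_le_of_dist_le G pos (D := 2 * (K ^ N * (N * (2 * L))))
    (by positivity) fun u v => by
      linarith [hall u, hall v, dist_triangle_right (pos u) (pos v) (pos r)]
  have : treeLength G pos / L ≤ (N : ℝ) ^ 2 * (2 * (K ^ N * (N * 2))) :=
    div_le_of_le_mul₀ hL (by positivity) (htree.trans (le_of_eq (by ring)))
  linarith

end Ratios

section SplitPos

variable {V E : Type*} {pos : V → E} {t : V} {p a b : E}

open Classical in
/-- The placement of `G.attachLeaves t` that moves `t` to `p` and puts the new leaves at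
`a` and `b`. -/
def splitPos (pos : V → E) (t : V) (p a b : E) : V ⊕ Bool → E :=
  Sum.elim (Function.update pos t p) (fun c => cond c a b)

@[simp] lemma splitPos_self : splitPos pos t p a b (Sum.inl t) = p := by
  simp [splitPos]

lemma splitPos_of_ne {x : V} (hx : x ≠ t) : splitPos pos t p a b (Sum.inl x) = pos x := by
  simp [splitPos, hx]

@[simp] lemma splitPos_inr (c : Bool) : splitPos pos t p a b (Sum.inr c) = cond c a b := rfl

end SplitPos

section Splitting

variable {E : Type*} [NormedAddCommGroup E] [InnerProductSpace ℝ E]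

lemma arccos_neg_half : Real.arccos (-(1 / 2)) = 2 * π / 3 := by
  rw [Real.arccos_neg, ← Real.cos_pi_div_three, Real.arccos_cos (by positivity)
    (by linarith [Real.pi_pos])]
  ring

lemma norm_sqrt_three_smul_sub {v w : E} (hv : ‖v‖ = 1) (hw : ‖w‖ = 1) (h : inner ℝ v w = 0) :
    ‖√3 • w - v‖ = 2 := by
  have h1 : ‖√3 • w - v‖ ^ 2 = 2 ^ 2 := by
    rw [norm_sub_sq_real, real_inner_smul_left, real_inner_comm, h, norm_smul, hv, hw,
      Real.norm_of_nonneg (Real.sqrt_nonneg 3), mul_one, Real.sq_sqrt (by norm_num)]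
    norm_num
  exact (sq_eq_sq₀ (norm_nonneg _) (by norm_num)).1 h1

lemma angle_sqrt_three_smul_sub {v w : E} (hv : ‖v‖ = 1) (hw : ‖w‖ = 1) (h : inner ℝ v w = 0) :
    InnerProductGeometry.angle v (√3 • w - v) = 2 * π / 3 := by
  rw [InnerProductGeometry.angle, norm_sqrt_three_smul_sub hv hw h, hv, inner_sub_right,
    real_inner_smul_right, h, real_inner_self_eq_norm_sq, hv, ← arccos_neg_half]
  norm_num

lemma angle_sqrt_three_smul_sub_neg {v w : E} (hv : ‖v‖ = 1) (hw : ‖w‖ = 1)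
    (h : inner ℝ v w = 0) :
    InnerProductGeometry.angle (√3 • w - v) (√3 • (-w) - v) = 2 * π / 3 := by
  rw [InnerProductGeometry.angle, norm_sqrt_three_smul_sub hv hw h,
    norm_sqrt_three_smul_sub hv (by rwa [norm_neg]) (by rw [inner_neg_right, h, neg_zero]),
    ← arccos_neg_half]
  congr 1
  have h' : inner ℝ w v = 0 := by rw [real_inner_comm, h]
  simp only [inner_sub_left, inner_sub_right, real_inner_smul_left, real_inner_smul_right,
    inner_neg_right, real_inner_self_eq_norm_sq, h, h', hv, hw]
  have := Real.mul_self_sqrt (show (0 : ℝ) ≤ 3 by norm_num)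
  nlinarith

/-- Splitting the endpoint `t` of the segment `ts` into two points at equal distances from `t`
on a perpendicular line creates a Fermat point on the segment. -/
lemma exists_fermat_split {s t w : E} (hst : s ≠ t) (hw : ‖w‖ = 1) (h : inner ℝ (s - t) w = 0) :
    ∃ v : E, ∀ k : ℝ, 0 < k → k < ‖s - t‖ →
      (∃ c : ℝ, 0 < c ∧ t + k • v - s = c • (t - s)) ∧
      EuclideanGeometry.angle s (t + k • v) (t + k • (√3 • w)) = 2 * π / 3 ∧
      EuclideanGeometry.angle s (t + k • v) (t + k • (√3 • (-w))) = 2 * π / 3 ∧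
      EuclideanGeometry.angle (t + k • (√3 • w)) (t + k • v) (t + k • (√3 • (-w))) =
        2 * π / 3 := by
  have hx : 0 < ‖s - t‖ := norm_pos_iff.2 (sub_ne_zero.2 hst)
  set v := ‖s - t‖⁻¹ • (s - t) with hv
  have hv1 : ‖v‖ = 1 := by rw [hv, norm_smul, norm_inv, norm_norm, inv_mul_cancel₀ hx.ne']
  have hvw : inner ℝ v w = 0 := by rw [hv, real_inner_smul_left, h, mul_zero]
  have hvw' : inner ℝ v (-w) = 0 := by rw [inner_neg_right, hvw, neg_zero]
  have hw' : ‖-w‖ = 1 := by rwa [norm_neg]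
  have hs : s = t + ‖s - t‖ • v := by
    rw [hv, smul_inv_smul₀ hx.ne']; abel
  refine ⟨v, fun k hk hk' => ⟨⟨(‖s - t‖ - k) / ‖s - t‖, div_pos (by linarith) hx, ?_⟩, ?_⟩⟩
  · rw [← neg_sub s t, smul_neg, div_eq_mul_inv, mul_smul, ← hv, sub_smul]
    nth_rewrite 1 [hs]
    abel
  · have e1 : s - (t + k • v) = (‖s - t‖ - k) • v := by
      nth_rewrite 1 [hs]
      rw [sub_smul]; abel
    have e2 : ∀ y : E, t + k • y - (t + k • v) = k • (y - v) := fun y => by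
      rw [smul_sub]; abel
    have hk2 : 0 < ‖s - t‖ - k := by linarith
    simp only [EuclideanGeometry.angle, vsub_eq_sub, e1, e2,
      InnerProductGeometry.angle_smul_right_of_pos _ _ hk,
      InnerProductGeometry.angle_smul_left_of_pos _ _ hk,
      InnerProductGeometry.angle_smul_left_of_pos _ _ hk2]
    exact ⟨angle_sqrt_three_smul_sub hv1 hw hvw, angle_sqrt_three_smul_sub hv1 hw' hvw',
      angle_sqrt_three_smul_sub_neg hv1 hw hvw⟩

lemma exists_norm_eq_one_orthogonal [FiniteDimensional ℝ E] (hE : 3 ≤ Module.finrank ℝ E)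
    (x y : E) : ∃ w : E, ‖w‖ = 1 ∧ inner ℝ x w = 0 ∧ inner ℝ y w = 0 := by
  classical
  set K := Submodule.span ℝ (({x, y} : Finset E) : Set E) with hK
  have hne : Kᗮ ≠ ⊥ := by
    intro h
    rw [Submodule.orthogonal_eq_bot_iff] at h
    have h1 : Module.finrank ℝ K ≤ _ := finrank_span_finset_le_card (R := ℝ) ({x, y} : Finset E)
    have h2 : Finset.card {x, y} ≤ 2 := Finset.card_le_two
    rw [h, finrank_top] at h1
    omega
  obtain ⟨w, hw, hw0⟩ := Submodule.exists_mem_ne_zero_of_ne_bot hne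
  have hmem := (Submodule.mem_orthogonal K w).1 hw
  refine ⟨‖w‖⁻¹ • w, norm_smul_inv_norm hw0, ?_, ?_⟩ <;>
    rw [real_inner_smul_right, hmem _ (Submodule.subset_span (by simp)), mul_zero]

open Filter Topology in
/-- Given segments `ts` and `ts'` with `t ≠ s'`, the point `t` can be split into two points such
that both segments get a Fermat point near `t`; if `s = t`, this point is `t` itself. -/
lemma exists_common_fermat_split [FiniteDimensional ℝ E] (hE : 3 ≤ Module.finrank ℝ E)
    {s s' t : E} (hs' : s' ≠ t) :
    ∃ v v' a b : E, ∀ᶠ k : ℝ in 𝓝[>] 0,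
      (∃ c : ℝ, 0 < c ∧ t + k • v - s = c • (t - s)) ∧
      (∃ c : ℝ, 0 < c ∧ t + k • v' - s' = c • (t - s')) ∧
      EuclideanGeometry.angle s' (t + k • v') (t + k • a) = 2 * π / 3 ∧
      EuclideanGeometry.angle s' (t + k • v') (t + k • b) = 2 * π / 3 ∧
      EuclideanGeometry.angle (t + k • a) (t + k • v') (t + k • b) = 2 * π / 3 ∧
      EuclideanGeometry.angle (t + k • a) (t + k • v) (t + k • b) = 2 * π / 3 ∧
      ((EuclideanGeometry.angle s (t + k • v) (t + k • a) = 2 * π / 3 ∧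
        EuclideanGeometry.angle s (t + k • v) (t + k • b) = 2 * π / 3) ∨
       (s = t ∧ EuclideanGeometry.angle s (t + k • v) (t + k • a) = π / 2 ∧
        EuclideanGeometry.angle s (t + k • v) (t + k • b) = π / 2)) := by
  obtain ⟨w, hw, h, h'⟩ := exists_norm_eq_one_orthogonal hE (s - t) (s' - t)
  have hx' : 0 < ‖s' - t‖ := norm_pos_iff.2 (sub_ne_zero.2 hs')
  by_cases hs : s = t
  · subst hs
    set u := ‖s' - s‖⁻¹ • (s' - s) with hu
    have hu1 : ‖u‖ = 1 := by rw [hu, norm_smul, norm_inv, norm_norm, inv_mul_cancel₀ hx'.ne']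
    have huw : inner ℝ u w = 0 := by rw [hu, real_inner_smul_left, h', mul_zero]
    have hus : s' - s = ‖s' - s‖ • u := by rw [hu, smul_inv_smul₀ hx'.ne']
    refine ⟨0, 0, √3 • w - u, √3 • (-w) - u, ?_⟩
    filter_upwards [self_mem_nhdsWithin] with k (hk : 0 < k)
    simp only [smul_zero, add_zero, EuclideanGeometry.angle, vsub_eq_sub, add_sub_cancel_left,
      InnerProductGeometry.angle_smul_right_of_pos _ _ hk,
      InnerProductGeometry.angle_smul_left_of_pos _ _ hk, sub_self,
      InnerProductGeometry.angle_zero_left]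
    rw [hus]
    simp only [InnerProductGeometry.angle_smul_left_of_pos _ _ hx']
    have h1 := angle_sqrt_three_smul_sub_neg hu1 hw huw
    exact ⟨⟨1, one_pos, by simp⟩, ⟨1, one_pos, by simp⟩, angle_sqrt_three_smul_sub hu1 hw huw,
      angle_sqrt_three_smul_sub hu1 (by rwa [norm_neg]) (by rw [inner_neg_right, huw, neg_zero]),
      h1, h1, Or.inr (by simp)⟩
  · have hx : 0 < ‖s - t‖ := norm_pos_iff.2 (sub_ne_zero.2 hs)
    obtain ⟨v, hv⟩ := exists_fermat_split hs hw h
    obtain ⟨v', hv'⟩ := exists_fermat_split hs' hw h'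
    refine ⟨v, v', √3 • w, √3 • (-w), ?_⟩
    filter_upwards [self_mem_nhdsWithin, nhdsWithin_le_nhds (Iio_mem_nhds hx),
      nhdsWithin_le_nhds (Iio_mem_nhds hx')] with k (hk : 0 < k) hk1 hk2
    obtain ⟨a1, a2, a3, a4⟩ := hv k hk hk1
    obtain ⟨b1, b2, b3, b4⟩ := hv' k hk hk2
    exact ⟨a1, b1, b2, b3, b4, a4, Or.inl ⟨a2, a3⟩⟩

section

variable {V : Type*} {G : SimpleGraph V} {pos : V → E} {s t : V} {p a b : E}

lemma exists_splitPos_sub_eq_smul (hs : ∀ y, G.Adj t y ↔ y = s)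
    (hp : ∃ c : ℝ, 0 < c ∧ p - pos s = c • (pos t - pos s)) {x u : V} (hxu : G.Adj x u)
    (hx : x ≠ t) :
    ∃ c : ℝ, 0 < c ∧ splitPos pos t p a b (Sum.inl u) - pos x = c • (pos u - pos x) := by
  by_cases hu : u = t
  · subst hu
    rw [(hs x).1 hxu.symm]
    simpa using hp
  · exact ⟨1, one_pos, by rw [splitPos_of_ne hu, one_smul]⟩

lemma angle_splitPos_of_ne {P : ℝ → Prop} (hs : ∀ y, G.Adj t y ↔ y = s)
    (hp : ∃ c : ℝ, 0 < c ∧ p - pos s = c • (pos t - pos s)) {x : V} (hx : x ≠ t)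
    (h : ∀ u v, G.Adj x u → G.Adj x v → u ≠ v →
      P (EuclideanGeometry.angle (pos u) (pos x) (pos v)))
    {u v : V ⊕ Bool} (hu : (G.attachLeaves t).Adj (Sum.inl x) u)
    (hv : (G.attachLeaves t).Adj (Sum.inl x) v) (huv : u ≠ v) :
    P (EuclideanGeometry.angle (splitPos pos t p a b u) (splitPos pos t p a b (Sum.inl x))
      (splitPos pos t p a b v)) := by
  rcases u with u | c
  · rcases v with v | c
    · obtain ⟨c, hc, hcu⟩ := exists_splitPos_sub_eq_smul (a := a) (b := b) hs hp hu hx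
      obtain ⟨c', hc', hcv⟩ := exists_splitPos_sub_eq_smul (a := a) (b := b) hs hp hv hx
      have := h u v hu hv (fun h => huv (by rw [h]))
      rw [EuclideanGeometry.angle, splitPos_of_ne hx, vsub_eq_sub, vsub_eq_sub, hcu, hcv,
        InnerProductGeometry.angle_smul_left_of_pos _ _ hc,
        InnerProductGeometry.angle_smul_right_of_pos _ _ hc']
      exact this
    · exact absurd hv hx
  · exact absurd hu hx

lemma angle_splitPos_self {P : ℝ → Prop} (hs : ∀ y, G.Adj t y ↔ y = s)
    (ha : P (EuclideanGeometry.angle (pos s) p a)) (hb : P (EuclideanGeometry.angle (pos s) p b))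
    (hab : P (EuclideanGeometry.angle a p b))
    {u v : V ⊕ Bool} (hu : (G.attachLeaves t).Adj (Sum.inl t) u)
    (hv : (G.attachLeaves t).Adj (Sum.inl t) v) (huv : u ≠ v) :
    P (EuclideanGeometry.angle (splitPos pos t p a b u) (splitPos pos t p a b (Sum.inl t))
      (splitPos pos t p a b v)) := by
  have hst : s ≠ t := ((hs s).2 rfl).ne.symm
  have ha' := ha
  have hb' := hb
  have hab' := hab
  rw [EuclideanGeometry.angle_comm] at ha' hb' hab'
  rcases u with u | c
  · obtain rfl := (hs u).1 hu
    rcases v with v | c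
    · obtain rfl := (hs v).1 hv
      exact absurd rfl huv
    · cases c <;> simpa [splitPos_of_ne hst]
  · rcases v with v | c'
    · obtain rfl := (hs v).1 hv
      cases c <;> simpa [splitPos_of_ne hst]
    · cases c <;> cases c' <;> first | exact absurd rfl huv | simpa

lemma splitPos_ne (hs : ∀ y, G.Adj t y ↔ y = s)
    (hp : ∃ c : ℝ, 0 < c ∧ p - pos s = c • (pos t - pos s))
    (h : ∀ u v, G.Adj u v → pos u ≠ pos v) (ha : p ≠ a) (hb : p ≠ b) {x y : V ⊕ Bool}
    (hxy : (G.attachLeaves t).Adj x y) : splitPos pos t p a b x ≠ splitPos pos t p a b y := by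
  have key : ∀ x y, x ≠ t → G.Adj x y →
      splitPos pos t p a b (Sum.inl y) ≠ splitPos pos t p a b (Sum.inl x) := by
    intro x y hx hxy
    obtain ⟨c, hc, hcy⟩ := exists_splitPos_sub_eq_smul (a := a) (b := b) hs hp hxy hx
    rw [splitPos_of_ne hx, ← sub_ne_zero, hcy]
    exact smul_ne_zero hc.ne' (sub_ne_zero.2 (h x y hxy).symm)
  have leaf : ∀ c, p ≠ cond c a b := by
    rintro (_ | _)
    · exact hb
    · exact ha
  rcases x with x | c <;> rcases y with y | c'
  · by_cases hx : x = t
    · subst hx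
      have hxy' : G.Adj x y := hxy
      exact key y x hxy'.ne.symm hxy'.symm
    · exact (key x y hx hxy).symm
  · obtain rfl : x = t := hxy
    simpa using leaf c'
  · obtain rfl : y = t := hxy
    simpa using (leaf c).symm
  · exact absurd hxy (by simp)

end

end Splitting

section Monotone

variable {n d : ℕ} {ε : ℝ}

/-- With at least three terminals, the neighbour of a terminal is a Steiner point. -/
lemma FullSteinerTopology.exists_adj_inl_iff (hn : 3 ≤ n) (G : FullSteinerTopology n)
    (t : Fin n) : ∃ k, ∀ y, G.graph.Adj (Sum.inl t) y ↔ y = Sum.inr k := by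
  obtain ⟨s, hs⟩ := Set.ncard_eq_one.1 (G.degTerminal t)
  have hs' : ∀ y, G.graph.Adj (Sum.inl t) y ↔ y = s := fun y => Set.ext_iff.1 hs y
  rcases s with j | k
  · exfalso
    obtain ⟨r, hr⟩ := Set.ncard_eq_one.1 (G.degTerminal j)
    have hr' : ∀ y, G.graph.Adj (Sum.inl j) y ↔ y = r := fun y => Set.ext_iff.1 hr y
    have htr : Sum.inl t = r := (hr' _).1 ((hs' _).2 rfl).symm
    have key : ∀ u v : SteinerVert n, G.graph.Walk u v →
        (u = Sum.inl t ∨ u = Sum.inl j) → (v = Sum.inl t ∨ v = Sum.inl j) := by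
      intro u v p
      induction p with
      | nil => exact id
      | cons h p ih =>
        rintro (rfl | rfl)
        · exact ih (Or.inr ((hs' _).1 h))
        · exact ih (Or.inl (((hr' _).1 h).trans htr.symm))
    obtain ⟨p⟩ := G.isTree.connected.preconnected (Sum.inl t) (Sum.inr ⟨0, by omega⟩)
    simpa using key _ _ p (Or.inl rfl)
  · exact ⟨k, hs'⟩

lemma IsApproxSteiner.attachLeaves {n' : ℕ} (hε : 0 ≤ ε) {G : FullSteinerTopology n}
    {pos : SteinerVert n → Epc d} (happ : IsApproxSteiner ε G pos) {i : Fin n} {k : Fin (n - 2)}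
    {G' : FullSteinerTopology n'} {e : SteinerVert n' ≃ SteinerVert n ⊕ Bool} {p a b : Epc d}
    (hadj : ∀ x y, G'.graph.Adj x y ↔ (G.graph.attachLeaves (Sum.inl i)).Adj (e x) (e y))
    (he : ∀ j, e (Sum.inr j) = Sum.inl (Sum.inl i) ∨ ∃ l, e (Sum.inr j) = Sum.inl (Sum.inr l))
    (hk : ∀ y, G.graph.Adj (Sum.inl i) y ↔ y = Sum.inr k)
    (hp : ∃ c : ℝ, 0 < c ∧ p - pos (Sum.inr k) = c • (pos (Sum.inl i) - pos (Sum.inr k)))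
    (hab : EuclideanGeometry.angle a p b = 2 * π / 3)
    (hor : (EuclideanGeometry.angle (pos (Sum.inr k)) p a = 2 * π / 3 ∧
        EuclideanGeometry.angle (pos (Sum.inr k)) p b = 2 * π / 3) ∨
      (pos (Sum.inr k) = pos (Sum.inl i) ∧
        EuclideanGeometry.angle (pos (Sum.inr k)) p a = π / 2 ∧
        EuclideanGeometry.angle (pos (Sum.inr k)) p b = π / 2)) :
    IsApproxSteiner ε G' (fun x => splitPos pos (Sum.inl i) p a b (e x)) := by
  intro j u w hu hw huw
  rw [hadj] at hu hw
  have huw' : e u ≠ e w := e.injective.ne huw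
  have h0 : |2 * π / 3 - 2 * π / 3| ≤ ε := by simpa using hε
  beta_reduce
  rcases he j with hj | ⟨j', hj⟩ <;> rw [hj] at hu hw ⊢
  · have hsplit : |EuclideanGeometry.angle (pos (Sum.inr k)) p a - 2 * π / 3| ≤ ε ∧
        |EuclideanGeometry.angle (pos (Sum.inr k)) p b - 2 * π / 3| ≤ ε := by
      rcases hor with ⟨h1, h2⟩ | ⟨hpos, h1, h2⟩
      · rw [h1, h2]
        exact ⟨h0, h0⟩
      · obtain ⟨z, hz, hzi⟩ := Set.exists_ne_of_one_lt_ncard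
          (show 1 < (G.graph.neighborSet (Sum.inr k)).ncard by rw [G.degSteiner k]; norm_num)
          (Sum.inl i)
        have := happ k (Sum.inl i) z ((hk _).2 rfl).symm hz hzi.symm
        rw [hpos, EuclideanGeometry.angle_self_left] at this
        rw [h1, h2]
        exact ⟨this, this⟩
    exact angle_splitPos_self (P := fun θ => |θ - 2 * π / 3| ≤ ε) hk hsplit.1 hsplit.2
      (by rw [hab]; exact h0) hu hw huw'
  · exact angle_splitPos_of_ne (P := fun θ => |θ - 2 * π / 3| ≤ ε) hk hp (by simp)
      (happ j') hu hw huw'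

lemma IsLocallyMinimumTree.attachLeaves {n' : ℕ} {G : FullSteinerTopology n}
    {pos : SteinerVert n → Epc d} (hloc : IsLocallyMinimumTree G pos) {s t : SteinerVert n}
    {G' : FullSteinerTopology n'} {e : SteinerVert n' ≃ SteinerVert n ⊕ Bool} {p a b : Epc d}
    (hadj : ∀ x y, G'.graph.Adj x y ↔ (G.graph.attachLeaves t).Adj (e x) (e y))
    (hs : ∀ y, G.graph.Adj t y ↔ y = s)
    (hp : ∃ c : ℝ, 0 < c ∧ p - pos s = c • (pos t - pos s))
    (ha : EuclideanGeometry.angle (pos s) p a = 2 * π / 3)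
    (hb : EuclideanGeometry.angle (pos s) p b = 2 * π / 3)
    (hab : EuclideanGeometry.angle a p b = 2 * π / 3) :
    IsLocallyMinimumTree G' (fun x => splitPos pos t p a b (e x)) := by
  have hne : ∀ y, EuclideanGeometry.angle (pos s) p y = 2 * π / 3 → p ≠ y := by
    rintro y hy rfl
    rw [EuclideanGeometry.angle_self_right] at hy
    linarith [Real.pi_pos]
  refine ⟨fun x y hxy =>
    splitPos_ne hs hp hloc.1 (hne a ha) (hne b hb) ((hadj x y).1 hxy), ?_⟩
  intro x u w hu hw huw
  rw [hadj] at hu hw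
  have huw' : e u ≠ e w := e.injective.ne huw
  beta_reduce
  generalize e x = x', e u = u', e w = w' at hu hw huw' ⊢
  rcases x' with z | c
  · by_cases hz : z = t
    · subst hz
      exact angle_splitPos_self (P := fun θ => 2 * π / 3 ≤ θ) hs ha.ge hb.ge hab.ge hu hw huw'
    · exact angle_splitPos_of_ne (P := fun θ => 2 * π / 3 ≤ θ) hs hp hz (hloc.2 z) hu hw huw'
  · rcases u' with y | c' <;> rcases w' with y' | c'' <;> simp_all

open Filter Topology in
/-- Splitting a terminal shows that errors on `n` terminals are limits of errors on `n + 1`. -/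
lemma steinerRatios_subset_closure (hd : 3 ≤ d) (hε : 0 < ε) (hn : 3 ≤ n) :
    steinerRatios d ε n ⊆ closure (steinerRatios d ε (n + 1)) := by
  rintro _ ⟨G, pos, pos', happ, ht, hmin, hloc, rfl⟩
  set i : Fin n := ⟨0, by omega⟩ with hi
  set t : SteinerVert n := Sum.inl i with htdef
  obtain ⟨k, hk⟩ := G.exists_adj_inl_iff hn i
  set s : SteinerVert n := Sum.inr k
  have hst : G.graph.Adj s t := ((hk s).2 rfl).symm
  have hti : pos' t = pos t := ht i
  obtain ⟨G', e, hadj, hel, her⟩ := G.exists_attachLeaves (by omega) i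
  obtain ⟨v, v', a, b, hev⟩ := exists_common_fermat_split (E := Epc d) (by simpa using hd)
    (s := pos s) (s' := pos' s) (t := pos t) (hti ▸ hloc.1 s t hst)
  set q : ℝ → SteinerVert (n + 1) → Epc d := fun h x =>
    splitPos pos t (pos t + h • v) (pos t + h • a) (pos t + h • b) (e x) with hq
  set q' : ℝ → SteinerVert (n + 1) → Epc d := fun h x =>
    splitPos pos' t (pos t + h • v') (pos t + h • a) (pos t + h • b) (e x) with hq'
  have hcont : ∀ (f : SteinerVert n → Epc d) (u : Epc d) (w : SteinerVert n ⊕ Bool),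
      Continuous fun h : ℝ =>
        splitPos f t (pos t + h • u) (pos t + h • a) (pos t + h • b) w := by
    rintro f u (x | c)
    · by_cases hx : x = t
      · subst hx
        simp only [splitPos_self]
        fun_prop
      · simp only [splitPos_of_ne hx]
        fun_prop
    · cases c <;> simp only [splitPos_inr, cond_true, cond_false] <;> fun_prop
  have hzero : ∀ (f : SteinerVert n → Epc d) (u : Epc d), f t = pos t → ∀ w,
      splitPos f t (pos t + (0 : ℝ) • u) (pos t + (0 : ℝ) • a) (pos t + (0 : ℝ) • b) w =
        Sum.elim f (fun _ => f t) w := by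
    rintro f u hf (x | c)
    · by_cases hx : x = t
      · subst hx
        simp [hf]
      · simp [splitPos_of_ne hx]
    · cases c <;> simp [hf]
  have hlim : Tendsto (fun h => treeLength G' (q h)) (𝓝[>] 0) (𝓝 (treeLength G pos)) := by
    have h1 := (continuous_treeLength G' fun x => hcont pos v (e x)).tendsto 0
    simp only [hzero pos v rfl] at h1
    rw [treeLength_attachLeaves hadj] at h1
    exact h1.mono_left nhdsWithin_le_nhds
  have hlim' : Tendsto (fun h => treeLength G' (q' h)) (𝓝[>] 0) (𝓝 (treeLength G pos')) := by
    have h1 := (continuous_treeLength G' fun x => hcont pos' v' (e x)).tendsto 0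
    simp only [hzero pos' v' hti] at h1
    rw [treeLength_attachLeaves hadj] at h1
    exact h1.mono_left nhdsWithin_le_nhds
  have hL := hloc.treeLength_pos hn
  rw [← hmin]
  refine mem_closure_of_tendsto ((hlim.div hlim' hL.ne').sub_const 1) ?_
  filter_upwards [hev] with h hgeom
  obtain ⟨hp, hp', ha', hb', hab', hab, hor⟩ := hgeom
  have hterm : ∀ j : Fin (n + 1), q' h (Sum.inl j) = q h (Sum.inl j) := by
    intro j
    simp only [hq, hq']
    rcases hel j with ⟨c, hc⟩ | ⟨j', hj', hc⟩ <;> rw [hc]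
    · simp
    · have : (Sum.inl j' : SteinerVert n) ≠ t := by simpa [htdef] using hj'
      rw [splitPos_of_ne this, splitPos_of_ne this, ht]
  have happ' : IsApproxSteiner ε G' (q h) := by
    refine happ.attachLeaves hε.le hadj her hk hp hab ?_
    rcases hor with hor | ⟨hs, h1, h2⟩
    · exact Or.inl hor
    · exact Or.inr ⟨hs, h1, h2⟩
  have hloc' : IsLocallyMinimumTree G' (q' h) :=
    hloc.attachLeaves hadj hk (hti ▸ hp') ha' hb' hab'
  exact ⟨G', q h, q' h, happ', hterm, (hloc'.minTreeLength_eq hterm).symm, hloc',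
    by rw [hloc'.minTreeLength_eq hterm]; rfl⟩

end Monotone

/-- `G_d(ε, n)` is monotone in `n` for `d ≥ 3`: for `ε > 0` and `n ≥ 3`,
`G_d(ε, n) ≤ G_d(ε, n+1)`. -/
theorem steinerG_monotone (d : ℕ) (hd : 3 ≤ d) (ε : ℝ) (hε : 0 < ε)
    (n : ℕ) (hn : 3 ≤ n) :
    steinerG d ε n ≤ steinerG d ε (n + 1) := by
  change sSup (steinerRatios d ε n) ≤ sSup (steinerRatios d ε (n + 1))
  have hnonneg : 0 ≤ sSup (steinerRatios d ε (n + 1)) :=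
    Real.sSup_nonneg fun r hr => steinerRatios_nonneg (by omega) hr
  rcases (steinerRatios d ε n).eq_empty_or_nonempty with hne | hne
  · rwa [hne, Real.sSup_empty]
  rcases lt_or_ge ε (2 * π / 3) with hlt | hge
  · have hsub : closure (steinerRatios d ε (n + 1)) ⊆
        Set.Iic (sSup (steinerRatios d ε (n + 1))) :=
      isClosed_Iic.closure_subset_iff.2 fun r hr =>
        le_csSup (bddAbove_steinerRatios (by omega) hε hlt) hr
    exact csSup_le hne fun r hr => hsub (steinerRatios_subset_closure hd hε hn hr)
  · rwa [Real.sSup_of_not_bddAbove (not_bddAbove_steinerRatios (by omega) hn hge hne)]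

end
end

section
/- Let n ≥ 3 and 0 ≤ ε ≤ π/6. Then for every full ε-approximate Steiner tree T on n terminals in ℝ² and every Steiner tree S in ℝ² on the same terminals with the same topology as T (degenerate edges allowed), L(T) ≤ (2n−3)·L(S). Equivalently, F_2(ε, n) ≤ 2n − 4. -/
open Real

noncomputable section

section TreeSums

theorem SimpleGraph.IsTree.eq_of_adj_of_dist_lt {V : Type*} {G : SimpleGraph V} (hG : G.IsTree)
    (x : V) {u₁ u₂ v : V} (h₁ : G.Adj u₁ v) (h₂ : G.Adj u₂ v)
    (hd₁ : G.dist x u₁ < G.dist x v) (hd₂ : G.dist x u₂ < G.dist x v) : u₁ = u₂ := by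
  have key : ∀ u, G.Adj u v → G.dist x u < G.dist x v →
      ∃ p : G.Walk x v, p.IsPath ∧ p.penultimate = u := by
    intro u hu hd
    obtain ⟨p, hp⟩ := hG.connected.exists_walk_length_eq_dist x u
    refine ⟨p.concat hu, ?_, by simp⟩
    apply SimpleGraph.Walk.isPath_of_length_eq_dist
    have := SimpleGraph.dist_le (p.concat hu)
    rw [SimpleGraph.Walk.length_concat] at this ⊢
    omega
  obtain ⟨p₁, hp₁, rfl⟩ := key u₁ h₁ hd₁
  obtain ⟨p₂, hp₂, rfl⟩ := key u₂ h₂ hd₂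
  rw [(hG.existsUnique_path x v).unique hp₁ hp₂]

open Classical in
/-- In a tree rooted at `x`, if `f` at each other vertex is bounded by the sum of `w + f` over
the edges to its children, then the same sum at the root is at most the total weight. -/
theorem SimpleGraph.IsTree.sum_root_le_of_le_sum_children {V : Type*} [Fintype V]
    {G : SimpleGraph V} (hG : G.IsTree) (x : V) (f : V → ℝ) (hf : ∀ v, 0 ≤ f v)
    (w : V → V → ℝ) (hw : ∀ u v, w u v = w v u)
    (h : ∀ v, v ≠ x →
      f v ≤ ∑ u, if G.Adj v u ∧ G.dist x v < G.dist x u then w v u + f u else 0) :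
    (∑ u, if G.Adj x u then w x u + f u else 0) ≤
      (1 / 2) * ∑ u, ∑ v, if G.Adj u v then w u v else 0 := by
  set P : V → V → Prop := fun v u => G.Adj v u ∧ G.dist x v < G.dist x u with hP
  have hweight : (∑ u, ∑ v, if G.Adj u v then w u v else 0) =
      2 * ∑ v, ∑ u, if P v u then w v u else 0 := by
    rw [two_mul]
    nth_rewrite 3 [Finset.sum_comm]
    simp only [← Finset.sum_add_distrib]
    refine Finset.sum_congr rfl fun u _ => Finset.sum_congr rfl fun v _ => ?_
    by_cases huv : G.Adj u v
    · have hne := hG.dist_ne_of_adj x huv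
      rcases lt_or_gt_of_ne hne with hlt | hlt
      · simp [hP, huv, huv.symm, hlt, hlt.le]
      · simp [hP, huv, huv.symm, hlt, hlt.le, hw u v]
    · simp [hP, huv, mt G.adj_symm huv]
  have hchild : (∑ v, ∑ u, if P v u then f u else 0) ≤ ∑ u, if u ≠ x then f u else 0 := by
    rw [Finset.sum_comm]
    refine Finset.sum_le_sum fun u _ => ?_
    by_cases hu : u = x
    · subst hu
      simp [hP]
    · rw [if_pos hu, ← Finset.sum_filter]
      simp only [Finset.sum_const, nsmul_eq_mul]
      have hcard : (Finset.univ.filter fun v => P v u).card ≤ 1 := by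
        refine Finset.card_le_one.2 fun a ha b hb => ?_
        simp only [Finset.mem_filter, Finset.mem_univ, true_and, hP] at ha hb
        exact hG.eq_of_adj_of_dist_lt x ha.1 hb.1 ha.2 hb.2
      exact mul_le_of_le_one_left (hf u) (by exact_mod_cast hcard)
  have hroot : (∑ u, if G.Adj x u then w x u + f u else 0) =
      ∑ u, if P x u then w x u + f u else 0 := by
    refine Finset.sum_congr rfl fun u _ => ?_
    by_cases hu : G.Adj x u
    · simp [hP, hu, hG.connected.pos_dist_of_ne hu.ne]
    · simp [hP, hu]
  have hsum : (∑ v, if v ≠ x then f v else 0) + (∑ u, if P x u then w x u + f u else 0) ≤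
      ∑ v, ∑ u, if P v u then w v u + f u else 0 := by
    rw [← Finset.sum_erase_add (a := x) Finset.univ
        (fun v => ∑ u, if P v u then w v u + f u else 0) (Finset.mem_univ x),
      ← Finset.sum_erase_add (a := x) Finset.univ
        (fun v => if v ≠ x then f v else 0) (Finset.mem_univ x)]
    simp only [ne_eq, not_true_eq_false, if_false, add_zero]
    gcongr with v hv
    have hvx := Finset.ne_of_mem_erase hv
    simpa [hvx] using h v hvx
  have hsplit : (∑ v, ∑ u, if P v u then w v u + f u else 0) =
      (∑ v, ∑ u, if P v u then w v u else 0) + ∑ v, ∑ u, if P v u then f u else 0 := by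
    simp only [← Finset.sum_add_distrib]
    refine Finset.sum_congr rfl fun u _ => Finset.sum_congr rfl fun v _ => ?_
    split_ifs <;> simp
  rw [hroot, hweight]
  linarith

end TreeSums

/-- A point seeing the segment `yz` at a non-acute angle lies in the ball with diameter `yz`, so
its distance to any point is at most the sum of the distances from `y` and `z` to that point. -/
theorem dist_le_dist_add_dist_of_pi_div_two_le_angle {E : Type*} [NormedAddCommGroup E]
    [InnerProductSpace ℝ E] {x y z : E} (h : π / 2 ≤ EuclideanGeometry.angle y x z) (p : E) :
    dist x p ≤ dist y p + dist z p := by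
  have hinner : inner ℝ (y - x) (z - x) ≤ 0 := by
    rw [← InnerProductGeometry.cos_angle_mul_norm_mul_norm]
    refine mul_nonpos_of_nonpos_of_nonneg ?_ (by positivity)
    refine Real.cos_nonpos_of_pi_div_two_le_of_le h ?_
    have := EuclideanGeometry.angle_le_pi y x z
    have hpi := Real.pi_pos
    simp only [EuclideanGeometry.angle, vsub_eq_sub] at this
    linarith
  have hball : ‖(y - x) + (z - x)‖ ≤ ‖y - z‖ := by
    refine le_of_sq_le_sq ?_ (norm_nonneg _)
    have h₁ := norm_add_sq_real (y - x) (z - x)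
    have h₂ := norm_sub_sq_real (y - x) (z - x)
    rw [sub_sub_sub_cancel_right] at h₂
    linarith
  have h₁ : ‖(2 : ℝ) • (x - p)‖ ≤ ‖(y - x) + (z - x)‖ + ‖(y - p) + (z - p)‖ := by
    rw [show (2 : ℝ) • (x - p) = ((y - p) + (z - p)) - ((y - x) + (z - x)) by
      rw [two_smul]; abel, add_comm ‖(y - x) + (z - x)‖]
    exact norm_sub_le _ _
  have h₂ : ‖y - z‖ ≤ ‖y - p‖ + ‖z - p‖ := by
    rw [show y - z = (y - p) - (z - p) by abel]
    exact norm_sub_le _ _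
  have h₃ := norm_add_le (y - p) (z - p)
  rw [norm_smul, Real.norm_ofNat] at h₁
  simp only [dist_eq_norm]
  linarith

section Steiner

variable {n d : ℕ} {G : FullSteinerTopology n} {pos pos' : SteinerVert n → Epc d}

open Classical in
theorem dist_le_sum_of_steiner_neighbors
    (hT : ∀ s u v, G.graph.Adj (Sum.inr s) u → G.graph.Adj (Sum.inr s) v → u ≠ v →
      π / 2 ≤ EuclideanGeometry.angle (pos u) (pos (Sum.inr s)) (pos v))
    (s : Fin (n - 2)) (Q : SteinerVert n → Prop)
    (hQ : ∀ a b, G.graph.Adj (Sum.inr s) a → G.graph.Adj (Sum.inr s) b →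
      ¬ Q a → ¬ Q b → a = b) :
    dist (pos (Sum.inr s)) (pos' (Sum.inr s)) ≤
      ∑ u, if G.graph.Adj (Sum.inr s) u ∧ Q u then
        dist (pos' (Sum.inr s)) (pos' u) + dist (pos u) (pos' u) else 0 := by
  obtain ⟨a, b, ha, hb, hQa, hQb, hab⟩ : ∃ a b, G.graph.Adj (Sum.inr s) a ∧
      G.graph.Adj (Sum.inr s) b ∧ Q a ∧ Q b ∧ a ≠ b := by
    obtain ⟨a, b, c, hab, hac, hbc, hset⟩ := Set.ncard_eq_three.1 (G.degSteiner s)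
    have hadj : ∀ u, u ∈ ({a, b, c} : Set (SteinerVert n)) → G.graph.Adj (Sum.inr s) u := by
      intro u hu
      rwa [← hset] at hu
    have ha := hadj a (by simp)
    have hb := hadj b (by simp)
    have hc := hadj c (by simp)
    by_cases hQa : Q a
    · by_cases hQb : Q b
      · exact ⟨a, b, ha, hb, hQa, hQb, hab⟩
      · exact ⟨a, c, ha, hc, hQa, by_contra fun h => hbc (hQ b c hb hc hQb h), hac⟩
    · exact ⟨b, c, hb, hc, by_contra fun h => hab (hQ a b ha hb hQa h),
        by_contra fun h => hac (hQ a c ha hc hQa h), hbc⟩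
  rw [← Finset.sum_filter]
  have hsub : ({a, b} : Finset (SteinerVert n)) ⊆
      Finset.univ.filter fun u => G.graph.Adj (Sum.inr s) u ∧ Q u := by
    intro u hu
    rcases Finset.mem_insert.1 hu with rfl | hu
    · simp [ha, hQa]
    · rw [Finset.mem_singleton.1 hu]
      simp [hb, hQb]
  refine le_trans ?_ (Finset.sum_le_sum_of_subset_of_nonneg hsub fun _ _ _ => by positivity)
  rw [Finset.sum_pair hab]
  have h := dist_le_dist_add_dist_of_pi_div_two_le_angle (hT s a b ha hb hab) (pos' (Sum.inr s))
  have h₁ := dist_triangle (pos a) (pos' a) (pos' (Sum.inr s))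
  have h₂ := dist_triangle (pos b) (pos' b) (pos' (Sum.inr s))
  rw [dist_comm (pos' a)] at h₁
  rw [dist_comm (pos' b)] at h₂
  linarith

/-- If all angles at Steiner points are non-acute, every edge is at most as long as any tree on
the same terminals with the same topology. -/
theorem dist_le_treeLength_of_adj
    (hT : ∀ s u v, G.graph.Adj (Sum.inr s) u → G.graph.Adj (Sum.inr s) v → u ≠ v →
      π / 2 ≤ EuclideanGeometry.angle (pos u) (pos (Sum.inr s)) (pos v))
    (hterm : ∀ t : Fin n, pos' (Sum.inl t) = pos (Sum.inl t))
    {x y : SteinerVert n} (hxy : G.graph.Adj x y) :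
    dist (pos x) (pos y) ≤ treeLength G pos' := by
  classical
  have hroot := G.isTree.sum_root_le_of_le_sum_children x (fun v => dist (pos v) (pos' v))
    (fun _ => dist_nonneg) (fun u v => dist (pos' u) (pos' v)) (fun _ _ => dist_comm _ _) (by
      rintro (t | s) hv
      · rw [hterm t, dist_self]
        exact Finset.sum_nonneg fun u _ => by split_ifs <;> positivity
      · convert dist_le_sum_of_steiner_neighbors (pos' := pos') hT s
          (fun u => G.graph.dist x (Sum.inr s) < G.graph.dist x u) fun a b ha hb hQa hQb => ?_
        exact G.isTree.eq_of_adj_of_dist_lt x ha.symm hb.symm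
          (lt_of_le_of_ne (not_lt.1 hQa) (G.isTree.dist_ne_of_adj x ha).symm)
          (lt_of_le_of_ne (not_lt.1 hQb) (G.isTree.dist_ne_of_adj x hb).symm))
  have hx : dist (pos x) (pos' x) ≤ ∑ u, if G.graph.Adj x u ∧ u ≠ y then
      dist (pos' x) (pos' u) + dist (pos u) (pos' u) else 0 := by
    rcases x with t | s
    · rw [hterm t, dist_self]
      exact Finset.sum_nonneg fun u _ => by split_ifs <;> positivity
    · convert dist_le_sum_of_steiner_neighbors (pos' := pos') hT s (fun u => u ≠ y)
        fun a b _ _ ha hb => ?_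
      rw [not_not.1 ha, not_not.1 hb]
  have hsplit : (∑ u, if G.graph.Adj x u then
        dist (pos' x) (pos' u) + dist (pos u) (pos' u) else 0) =
      (∑ u, if G.graph.Adj x u ∧ u ≠ y then
        dist (pos' x) (pos' u) + dist (pos u) (pos' u) else 0) +
      (dist (pos' x) (pos' y) + dist (pos y) (pos' y)) := by
    rw [← Finset.sum_erase_add _ _ (Finset.mem_univ y),
      ← Finset.sum_erase_add (a := y) Finset.univ
        (fun u => if G.graph.Adj x u ∧ u ≠ y then _ else _) (Finset.mem_univ y)]
    simp only [hxy, if_true, ne_eq, not_true_eq_false, and_false, if_false, add_zero]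
    congr 1
    refine Finset.sum_congr rfl fun u hu => ?_
    simp [Finset.ne_of_mem_erase hu]
  have h₁ := dist_triangle4 (pos x) (pos' x) (pos' y) (pos y)
  rw [dist_comm (pos' y) (pos y)] at h₁
  have h₂ : treeLength G pos' =
    (1 / 2) * ∑ u, ∑ v, if G.graph.Adj u v then dist (pos' u) (pos' v) else 0 := rfl
  linarith

open Classical in
theorem treeLength_le_of_forall_dist_le (hn : 2 ≤ n) {D : ℝ}
    (hD : ∀ u v, G.graph.Adj u v → dist (pos u) (pos v) ≤ D) :
    treeLength G pos ≤ (2 * (n : ℝ) - 3) * D := by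
  have hvertex : ∀ u, (∑ v, if G.graph.Adj u v then dist (pos u) (pos v) else 0) ≤
      ((G.graph.neighborSet u).ncard : ℝ) * D := by
    intro u
    rw [← Finset.sum_filter, Set.ncard_eq_toFinset_card', ← nsmul_eq_mul]
    have hset : (G.graph.neighborSet u).toFinset = Finset.univ.filter fun v => G.graph.Adj u v := by
      ext v
      simp
    rw [hset]
    exact Finset.sum_le_card_nsmul _ _ _ fun v hv => hD u v (by simpa using hv)
  have hsum := Finset.sum_le_sum fun u (_ : u ∈ Finset.univ) => hvertex u
  rw [Fintype.sum_sum_type (fun u => ((G.graph.neighborSet u).ncard : ℝ) * D)] at hsum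
  simp only [G.degTerminal, G.degSteiner, Finset.sum_const, Finset.card_univ, Fintype.card_fin,
    nsmul_eq_mul, Nat.cast_sub hn] at hsum
  unfold treeLength
  push_cast at hsum
  linarith

end Steiner

/-- If `n ≥ 3` and `0 ≤ ε ≤ π/6`, then for every full `ε`-approximate Steiner tree `T` on
`n` terminals in `ℝ²` and every Steiner tree `S` on the same terminals with the same
topology, `L(T) ≤ (2n-3)·L(S)`; i.e. `F₂(ε, n) ≤ 2n - 4`. -/
theorem steiner_plane_crude_upper_bound (n : ℕ) (hn : 3 ≤ n)
    (ε : ℝ) (hε0 : 0 ≤ ε) (hε : ε ≤ π / 6)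
    (G : FullSteinerTopology n) (pos : SteinerVert n → Epc 2)
    (hT : IsApproxSteiner ε G pos)
    (pos' : SteinerVert n → Epc 2)
    (hterm : ∀ t : Fin n, pos' (Sum.inl t) = pos (Sum.inl t)) :
    treeLength G pos ≤ (2 * (n : ℝ) - 3) * treeLength G pos' := by
  refine treeLength_le_of_forall_dist_le (by omega) fun u v huv =>
    dist_le_treeLength_of_adj (fun s a b ha hb hab => ?_) hterm huv
  have := (abs_le.1 (hT s a b ha hb hab)).1
  linarith

end
end

section
/- Let a, b, c be points in Euclidean space ℝ^d with b ≠ a and b ≠ c, and let θ = π − ∠abc be the exterior angle of the triangle at b. Then (‖a − b‖ + ‖b − c‖)·cos(θ/2) ≤ ‖a − c‖. -/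
open Real

noncomputable section

/-- Reverse triangle inequality: in a triangle `abc` with exterior angle `θ = π - ∠abc`
at `b`, one has `(‖a - b‖ + ‖b - c‖)·cos(θ/2) ≤ ‖a - c‖`. -/
theorem reverse_triangle_inequality (d : ℕ) (a b c : Epc d)
    (hba : b ≠ a) (hbc : b ≠ c) :
    (‖a - b‖ + ‖b - c‖) * Real.cos ((π - EuclideanGeometry.angle a b c) / 2) ≤ ‖a - c‖ := by
  have law := EuclideanGeometry.law_cos a b c
  rw [dist_comm c b] at law
  simp only [← dist_eq_norm]
  set t := (π - EuclideanGeometry.angle a b c) / 2 with ht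
  have hcos : Real.cos (EuclideanGeometry.angle a b c) = 1 - 2 * Real.cos t ^ 2 := by
    rw [show EuclideanGeometry.angle a b c = π - 2 * t by rw [ht]; ring, Real.cos_pi_sub,
      Real.cos_two_mul]
    ring
  rw [hcos] at law
  refine abs_le_of_sq_le_sq' ?_ dist_nonneg |>.2
  nlinarith [mul_nonneg (sq_nonneg (dist a b - dist b c)) (sub_nonneg.2 (Real.cos_sq_le_one t))]

end
end

section
/- Let d ≥ 2, let 0 ≤ ε < 2π/3, and let s, t₁, t₂ ∈ ℝ^d with s ≠ t₁, s ≠ t₂ and ∠t₁st₂ ≥ 2π/3 − ε. Then (‖s − t₁‖ + ‖s − t₂‖)·sin(π/3 − ε/2) ≤ ‖t₁ − t₂‖. -/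
open Real

noncomputable section

/-- If `x` and `y` span an angle of at least `2 * φ`, with `0 ≤ φ`, then
`(‖x‖ + ‖y‖) * sin φ ≤ ‖x - y‖`. -/
theorem norm_add_norm_mul_sin_le_norm_sub {V : Type*} [NormedAddCommGroup V]
    [InnerProductSpace ℝ V] {x y : V} {φ : ℝ} (hφ : 0 ≤ φ)
    (h : 2 * φ ≤ InnerProductGeometry.angle x y) :
    (‖x‖ + ‖y‖) * Real.sin φ ≤ ‖x - y‖ := by
  have hlaw :=
    InnerProductGeometry.norm_sub_sq_eq_norm_sq_add_norm_sq_sub_two_mul_norm_mul_norm_mul_cos_angle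
      x y
  have hcos : Real.cos (InnerProductGeometry.angle x y) ≤ 1 - 2 * Real.sin φ ^ 2 := by
    have htwo : Real.cos (2 * φ) = 1 - 2 * Real.sin φ ^ 2 := by
      rw [Real.cos_two_mul, Real.cos_sq']
      ring
    rw [← htwo]
    exact Real.cos_le_cos_of_nonneg_of_le_pi (by positivity)
      (InnerProductGeometry.angle_le_pi x y) h
  have hmul := mul_le_mul_of_nonneg_left hcos (mul_nonneg (norm_nonneg x) (norm_nonneg y))
  have hsq := mul_nonneg (sq_nonneg (‖x‖ - ‖y‖)) (sub_nonneg.2 (Real.sin_sq_le_one φ))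
  refine abs_le_of_sq_le_sq' ?_ (norm_nonneg _) |>.2
  nlinarith

/-- Cherry estimate: if `d ≥ 2`, `0 ≤ ε < 2π/3` and `∠ t₁ s t₂ ≥ 2π/3 - ε`, then
`(‖s - t₁‖ + ‖s - t₂‖)·sin(π/3 - ε/2) ≤ ‖t₁ - t₂‖`. -/
theorem cherry_length_bound (d : ℕ) (hd : 2 ≤ d) (ε : ℝ) (hε0 : 0 ≤ ε)
    (hε : ε < 2 * π / 3) (s t₁ t₂ : Epc d) (h1 : s ≠ t₁) (h2 : s ≠ t₂)
    (hang : 2 * π / 3 - ε ≤ EuclideanGeometry.angle t₁ s t₂) :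
    (‖s - t₁‖ + ‖s - t₂‖) * Real.sin (π / 3 - ε / 2) ≤ ‖t₁ - t₂‖ := by
  have h := norm_add_norm_mul_sin_le_norm_sub (x := t₁ - s) (y := t₂ - s)
    (φ := π / 3 - ε / 2) (by linarith) (le_trans (by linarith) hang)
  rwa [sub_sub_sub_cancel_right, norm_sub_rev t₁ s, norm_sub_rev t₂ s] at h

end
end

section
/- Let d ≥ 2, let 0 ≤ ε < 2π/3, let D > 0, and let t, t₁, t₂, s ∈ ℝ^d with s ≠ t₁, s ≠ t₂, ‖t − t₁‖ ≤ D, ‖t − t₂‖ ≤ D, ‖t₁ − t₂‖ ≤ D, and ∠t₁st₂ ≥ 2π/3 − ε. Then ‖t − s‖ ≤ D·cos(ε/2)/sin(π/3 − ε/2). -/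
open Real

noncomputable section

/-- If `(q, b)` lies in the upper half plane and its polar angle is at least `θ`, expressed
through the cosine, then `q sin θ ≤ b cos θ`. -/
lemma mul_sin_le_mul_cos_of_le_cos_mul {q b N θ : ℝ} (hb : 0 ≤ b) (hN : 0 ≤ N)
    (hNq : N ^ 2 = q ^ 2 + b ^ 2) (hs : 0 ≤ sin θ) (h : q ≤ cos θ * N) :
    q * sin θ ≤ b * cos θ := by
  have hsc := sin_sq_add_cos_sq θ
  rcases le_total 0 (cos θ) with hc | hc
  · rcases le_total q 0 with hq | hq
    · exact (mul_nonpos_of_nonpos_of_nonneg hq hs).trans (mul_nonneg hb hc)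
    · refine abs_le_of_sq_le_sq' ?_ (mul_nonneg hb hc) |>.2
      have h2 : q ^ 2 ≤ (cos θ * N) ^ 2 := pow_le_pow_left₀ hq h 2
      have h3 : (cos θ * N) ^ 2 = cos θ ^ 2 * (q ^ 2 + b ^ 2) := by rw [mul_pow, hNq]
      have h4 : (q * sin θ) ^ 2 = q ^ 2 - q ^ 2 * cos θ ^ 2 := by
        rw [mul_pow, sin_sq]; ring
      nlinarith
  · have h1 : 0 ≤ -cos θ * N := mul_nonneg (neg_nonneg.2 hc) hN
    have h2 : (-cos θ * N) ^ 2 ≤ (-q) ^ 2 := pow_le_pow_left₀ h1 (by linarith) 2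
    have h3 : (-cos θ * N) ^ 2 = cos θ ^ 2 * (q ^ 2 + b ^ 2) := by rw [mul_pow, hNq]; ring
    have h4 : (-q * sin θ) ^ 2 = q ^ 2 - q ^ 2 * cos θ ^ 2 := by
      rw [mul_pow, sin_sq]; ring
    have h5 : b * -cos θ ≤ -q * sin θ := by
      refine abs_le_of_sq_le_sq' ?_ (mul_nonneg (by linarith) hs) |>.2
      nlinarith
    linarith

/-- Among the points `(y, k)` of the upper half of the lens of points at distance at most `D` from
`(a, 0)` and `(-a, 0)`, the apex `(0, g)` is farthest from `(0, f)`, provided `f ≤ a / √3`. -/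
lemma lens_apex_farthest {a D g f y k : ℝ} (ha : 0 < a) (haD : 2 * a ≤ D) (hg : 0 ≤ g)
    (hgD : g ^ 2 = D ^ 2 - a ^ 2) (hf : √3 * f ≤ a) (hy : 0 ≤ y) (hk : 0 ≤ k)
    (hyk : (y + a) ^ 2 + k ^ 2 ≤ D ^ 2) :
    y ^ 2 + (k - f) ^ 2 ≤ (g - f) ^ 2 := by
  have h3 : √3 ^ 2 = 3 := sq_sqrt (by norm_num)
  have h3pos : 0 < √3 := by positivity
  have hay : 0 ≤ a * y := by positivity
  have hkg : k ≤ g := abs_le_of_sq_le_sq' (by nlinarith) hg |>.2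
  obtain ⟨e, he⟩ : ∃ e, √3 * e = a := ⟨a / √3, by field_simp⟩
  have hfe : f ≤ e := le_of_mul_le_mul_left (by linarith) h3pos
  have he0 : 0 < e := pos_of_mul_pos_right (he ▸ ha) h3pos.le
  have hyD : y + a ≤ D := abs_le_of_sq_le_sq' (by nlinarith) (by linarith) |>.2
  have hgle : g ≤ √3 * (D - a) := by
    refine abs_le_of_sq_le_sq' ?_ (mul_nonneg h3pos.le (by linarith)) |>.2
    rw [mul_pow, h3]
    nlinarith
  have hgge : D + a ≤ √3 * g := by
    refine abs_le_of_sq_le_sq' ?_ (by positivity) |>.2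
    rw [mul_pow, h3]
    nlinarith
  have hbase : 0 ≤ g ^ 2 - y ^ 2 - 2 * e * g := by
    have h1 : e * g ≤ a * (D - a) := by
      calc e * g ≤ e * (√3 * (D - a)) := by gcongr
        _ = a * (D - a) := by rw [← he]; ring
    nlinarith
  obtain ⟨K, hK0, hK⟩ : ∃ K, 0 ≤ K ∧ K ^ 2 = D ^ 2 - (y + a) ^ 2 :=
    ⟨√(D ^ 2 - (y + a) ^ 2), sqrt_nonneg _, sq_sqrt (by nlinarith)⟩
  have hkK : k ≤ K := abs_le_of_sq_le_sq' (by linarith) hK0 |>.2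
  have harc : 2 * e * (g - K) ≤ g ^ 2 - y ^ 2 - K ^ 2 := by
    have h1 : (g - K) * (g + K) = y * (y + 2 * a) := by nlinarith
    have h2 : y + 2 * a ≤ √3 * (g + K) := by nlinarith
    have h4 : g - K ≤ √3 * y := by
      have h5 : 0 < g + K := by nlinarith
      refine le_of_mul_le_mul_right ?_ h5
      nlinarith
    have h6 : e * (g - K) ≤ e * (√3 * y) := by gcongr
    have h7 : e * (√3 * y) = a * y := by rw [← he]; ring
    nlinarith
  have key : 2 * e * (g - k) ≤ g ^ 2 - y ^ 2 - k ^ 2 := by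
    rcases le_total (2 * e) (K + k) with h | h
    · nlinarith [mul_nonneg (sub_nonneg.2 hkK) (sub_nonneg.2 h)]
    · nlinarith
  nlinarith [mul_nonneg (sub_nonneg.2 hfe) (sub_nonneg.2 hkg)]

/-- The triangle inequality in the plane, in coordinates. -/
lemma sq_add_sq_le_sq_of_sq_add_sq_le {x₁ y₁ x₂ y₂ r₁ r₂ : ℝ} (hr₁ : 0 ≤ r₁) (hr₂ : 0 ≤ r₂)
    (h₁ : x₁ ^ 2 + y₁ ^ 2 ≤ r₁ ^ 2) (h₂ : x₂ ^ 2 + y₂ ^ 2 ≤ r₂ ^ 2) :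
    (x₁ + x₂) ^ 2 + (y₁ + y₂) ^ 2 ≤ (r₁ + r₂) ^ 2 := by
  have h : x₁ * x₂ + y₁ * y₂ ≤ r₁ * r₂ := by
    refine abs_le_of_sq_le_sq' ?_ (mul_nonneg hr₁ hr₂) |>.2
    have := mul_le_mul h₁ h₂ (by positivity) (by positivity)
    nlinarith [sq_nonneg (x₁ * y₂ - x₂ * y₁)]
  nlinarith

/-- In the plane, with terminals `(± a, 0)`: the distance from a point `(y, k)` of the lens of points
at distance at most `D` from both terminals to a point `(x, -p)` of the opposite circular cap
through the terminals. Here `c` and `b` are the cotangent and the tangent of half the angle of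
the cap. -/
lemma sq_dist_le_of_mem_lens_of_mem_spindle {a D b c x p y k : ℝ} (ha : 0 < a) (haD : 2 * a ≤ D)
    (hc0 : 0 < c) (hb0 : 0 < b) (hcc : c * b = 1) (htan : b ≤ √3) (hk : 0 ≤ k)
    (hlens : (|y| + a) ^ 2 + k ^ 2 ≤ D ^ 2) (hv : x ^ 2 + p ^ 2 ≤ a ^ 2 + a * (c - b) * p) :
    (y - x) ^ 2 + (k + p) ^ 2 ≤ (D * ((c + √3) / 2)) ^ 2 := by
  have h3 : √3 ^ 2 = 3 := sq_sqrt (by norm_num)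
  have h3pos : 0 < √3 := by positivity
  have hc3 : 1 ≤ √3 * c := by
    rw [← hcc, mul_comm c]
    gcongr
  obtain ⟨g, hg0, hg⟩ : ∃ g, 0 ≤ g ∧ g ^ 2 = D ^ 2 - a ^ 2 :=
    ⟨√(D ^ 2 - a ^ 2), sqrt_nonneg _, sq_sqrt (by nlinarith)⟩
  have hga : √3 * a ≤ g := by
    refine abs_le_of_sq_le_sq' ?_ hg0 |>.2
    rw [mul_pow, h3]
    nlinarith
  have hf : √3 * (a * (b - c) / 2) ≤ a := by
    have : √3 * (b - c) ≤ 2 := by linarith [mul_le_mul_of_nonneg_left htan h3pos.le]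
    linarith [mul_le_mul_of_nonneg_left this ha.le]
  have hz := lens_apex_farthest ha haD hg0 hg hf (abs_nonneg y) hk hlens
  rw [sq_abs] at hz
  have hv' : (-x) ^ 2 + (p + a * (b - c) / 2) ^ 2 ≤ (a * (b + c) / 2) ^ 2 := by
    linear_combination hv - a ^ 2 * hcc
  have hρ : 0 ≤ g - a * (b - c) / 2 := by
    linarith [mul_le_mul_of_nonneg_left htan ha.le, mul_pos ha hb0, mul_pos ha hc0]
  have hsum := sq_add_sq_le_sq_of_sq_add_sq_le hρ (by positivity) hz hv'
  have hg2 : √3 * g ≤ 2 * D - a := by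
    refine abs_le_of_sq_le_sq' ?_ (by linarith) |>.2
    rw [mul_pow, h3]
    nlinarith [sq_nonneg (D - 2 * a)]
  have hfin : √3 * (g + a * c) ≤ √3 * (D * ((c + √3) / 2)) := by
    linear_combination hg2 + (1 / 2) * mul_nonneg (sub_nonneg.2 hc3) (sub_nonneg.2 haD) -
      (D / 2) * h3
  calc (y - x) ^ 2 + (k + p) ^ 2 ≤ (g + a * c) ^ 2 := by linear_combination hsum
    _ ≤ _ := pow_le_pow_left₀ (by positivity) (le_of_mul_le_mul_left hfin h3pos) 2

section InnerProductSpace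

variable {E : Type*} [NormedAddCommGroup E] [InnerProductSpace ℝ E]

lemma norm_sub_inner_smul_sq {u : E} (hu : ‖u‖ = 1) (v : E) :
    ‖v - inner ℝ v u • u‖ ^ 2 = ‖v‖ ^ 2 - inner ℝ v u ^ 2 := by
  rw [norm_sub_sq_real, inner_smul_right, norm_smul, hu, mul_one, norm_eq_abs, sq_abs]
  ring

lemma norm_sub_sq_le_of_unit {u : E} (hu : ‖u‖ = 1) (z v : E) :
    ‖z - v‖ ^ 2 ≤ (inner ℝ z u - inner ℝ v u) ^ 2 +
      (‖z - inner ℝ z u • u‖ + ‖v - inner ℝ v u • u‖) ^ 2 := by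
  have h := neg_le_of_abs_le (abs_real_inner_le_norm (z - inner ℝ z u • u) (v - inner ℝ v u • u))
  have h' : inner ℝ (z - inner ℝ z u • u) (v - inner ℝ v u • u) =
      inner ℝ z v - inner ℝ z u * inner ℝ v u := by
    simp only [inner_sub_left, inner_sub_right, inner_smul_left, inner_smul_right,
      real_inner_self_eq_norm_sq, hu, real_inner_comm v u, conj_trivial]
    ring
  rw [norm_sub_sq_real]
  nlinarith [norm_sub_inner_smul_sq hu z, norm_sub_inner_smul_sq hu v]

/-- A point `v` seeing the segment from `-a u` to `a u` under an angle at least `2 α` lies in the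
spindle bounded by the corresponding circular arcs. -/
lemma norm_sq_le_of_two_mul_le_angle {u v : E} (hu : ‖u‖ = 1) {a α : ℝ} (ha : 0 ≤ a)
    (hα0 : 0 < α) (hα : α < π / 2)
    (h : 2 * α ≤ InnerProductGeometry.angle (a • u - v) (-(a • u) - v)) :
    ‖v‖ ^ 2 ≤ a ^ 2 +
      a * (cos α / sin α - sin α / cos α) * ‖v - inner ℝ v u • u‖ := by
  have hsin : 0 < sin α := sin_pos_of_pos_of_lt_pi hα0 (by linarith)
  have hcos : 0 < cos α := cos_pos_of_mem_Ioo ⟨by linarith, hα⟩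
  have hle := cos_le_cos_of_nonneg_of_le_pi (by linarith) (InnerProductGeometry.angle_le_pi _ _) h
  have hin := InnerProductGeometry.cos_angle_mul_norm_mul_norm (a • u - v) (-(a • u) - v)
  have hperp := norm_sub_inner_smul_sq hu v
  set p := ‖v - inner ℝ v u • u‖
  have hau : ‖a • u‖ = a := by rw [norm_smul, hu, mul_one, norm_of_nonneg ha]
  have hvau : inner ℝ v (a • u) = a * inner ℝ v u := inner_smul_right _ _ _
  have hq : inner ℝ (a • u - v) (-(a • u) - v) = ‖v‖ ^ 2 - a ^ 2 := by
    simp only [inner_sub_left, inner_sub_right, inner_neg_right, real_inner_self_eq_norm_sq]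
    rw [hau, real_inner_comm v (a • u)]
    ring
  have hn1 : ‖a • u - v‖ ^ 2 = a ^ 2 - 2 * (a * inner ℝ v u) + ‖v‖ ^ 2 := by
    rw [norm_sub_sq_real, real_inner_comm, hvau, hau]
  have hn2 : ‖-(a • u) - v‖ ^ 2 = a ^ 2 + 2 * (a * inner ℝ v u) + ‖v‖ ^ 2 := by
    rw [norm_sub_sq_real, inner_neg_left, norm_neg, real_inner_comm, hvau, hau]
    ring
  have hmain := mul_sin_le_mul_cos_of_le_cos_mul (q := ‖v‖ ^ 2 - a ^ 2) (b := 2 * a * p)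
    (N := ‖a • u - v‖ * ‖-(a • u) - v‖) (θ := 2 * α) (by positivity) (by positivity)
    (by rw [mul_pow, hn1, hn2, mul_pow, hperp]; ring)
    (sin_nonneg_of_nonneg_of_le_pi (by linarith) (by linarith))
    (by rw [← hq, ← hin]; gcongr)
  rw [sin_two_mul, cos_two_mul'] at hmain
  have hdiv : (‖v‖ ^ 2 - a ^ 2) * (2 * sin α * cos α) ≤
      (a * (cos α / sin α - sin α / cos α) * p) * (2 * sin α * cos α) := by
    refine hmain.trans_eq ?_
    field_simp
  linarith [le_of_mul_le_mul_right hdiv (by positivity)]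

/-- The cherry estimate with the origin at the midpoint of the two terminals `± a u`. -/
lemma norm_sub_le_of_two_mul_le_angle {u v z : E} (hu : ‖u‖ = 1) {a α D : ℝ} (ha : 0 < a)
    (haD : 2 * a ≤ D) (hα0 : 0 < α) (hα : α ≤ π / 3)
    (h1 : ‖z - a • u‖ ≤ D) (h2 : ‖z + a • u‖ ≤ D)
    (h : 2 * α ≤ InnerProductGeometry.angle (a • u - v) (-(a • u) - v)) :
    ‖z - v‖ ≤ D * (cos (π / 3 - α) / sin α) := by
  have hsin : 0 < sin α := sin_pos_of_pos_of_lt_pi hα0 (by linarith [pi_pos])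
  have hcos : 0 < cos α := cos_pos_of_mem_Ioo ⟨by linarith, by linarith [pi_pos]⟩
  have hsc : sin α ≤ √3 * cos α := by
    have := sin_nonneg_of_nonneg_of_le_pi (x := π / 3 - α) (by linarith) (by linarith [pi_pos])
    rw [sin_sub, sin_pi_div_three, cos_pi_div_three] at this
    linarith
  have hspindle := norm_sq_le_of_two_mul_le_angle hu ha.le hα0 (by linarith [pi_pos]) h
  have hvp := norm_sub_inner_smul_sq hu v
  have hzp := norm_sub_inner_smul_sq hu z
  have hD : 0 ≤ D := by linarith
  have hdist := norm_sub_sq_le_of_unit hu z v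
  have hp0 := norm_nonneg (z - inner ℝ z u • u)
  set k := ‖z - inner ℝ z u • u‖
  set p := ‖v - inner ℝ v u • u‖
  set x := inner ℝ v u
  set y := inner ℝ z u with hy
  have hlens : (|y| + a) ^ 2 + k ^ 2 ≤ D ^ 2 := by
    have hau : ‖a • u‖ = a := by rw [norm_smul, hu, mul_one, norm_of_nonneg ha.le]
    have e1 := pow_le_pow_left₀ (norm_nonneg _) h1 2
    have e2 := pow_le_pow_left₀ (norm_nonneg _) h2 2
    rw [norm_sub_sq_real, inner_smul_right, hau, ← hy] at e1
    rw [norm_add_sq_real, inner_smul_right, hau, ← hy] at e2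
    rcases abs_cases y with ⟨hy', -⟩ | ⟨hy', -⟩ <;> rw [hy'] <;> nlinarith
  have hcc : cos α / sin α * (sin α / cos α) = 1 := by field_simp
  have htan : sin α / cos α ≤ √3 := by rwa [div_le_iff₀ hcos]
  have hrhs : cos (π / 3 - α) / sin α = (cos α / sin α + √3) / 2 := by
    rw [cos_sub, sin_pi_div_three, cos_pi_div_three]
    field_simp
  have hc0 : 0 < cos α / sin α := by positivity
  have hb0 : 0 < sin α / cos α := by positivity
  rw [hrhs]
  set c := cos α / sin α
  set b := sin α / cos α
  exact abs_le_of_sq_le_sq' (hdist.trans (sq_dist_le_of_mem_lens_of_mem_spindle ha haD hc0 hb0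
    hcc htan hp0 hlens (by linarith))) (by positivity) |>.2

end InnerProductSpace

/-- Cherry Steiner-point distance estimate: if `d ≥ 2`, `0 ≤ ε < 2π/3`, `D > 0`,
`‖t - t₁‖, ‖t - t₂‖, ‖t₁ - t₂‖ ≤ D` and `∠ t₁ s t₂ ≥ 2π/3 - ε`, then
`‖t - s‖ ≤ D·cos(ε/2)/sin(π/3 - ε/2)`. -/
theorem cherry_steiner_point_bound (d : ℕ) (hd : 2 ≤ d) (ε : ℝ) (hε0 : 0 ≤ ε)
    (hε : ε < 2 * π / 3) (D : ℝ) (hD : 0 < D) (t t₁ t₂ s : Epc d)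
    (h1 : s ≠ t₁) (h2 : s ≠ t₂)
    (hd1 : ‖t - t₁‖ ≤ D) (hd2 : ‖t - t₂‖ ≤ D) (hd3 : ‖t₁ - t₂‖ ≤ D)
    (hang : 2 * π / 3 - ε ≤ EuclideanGeometry.angle t₁ s t₂) :
    ‖t - s‖ ≤ D * Real.cos (ε / 2) / Real.sin (π / 3 - ε / 2) := by
  rw [EuclideanGeometry.angle, vsub_eq_sub, vsub_eq_sub] at hang
  have hne : t₁ - t₂ ≠ 0 := by
    intro h
    rw [sub_eq_zero.1 h, InnerProductGeometry.angle_self (sub_ne_zero.2 h2.symm)] at hang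
    linarith
  have hpos : 0 < ‖t₁ - t₂‖ := norm_pos_iff.2 hne
  have hu : ‖‖t₁ - t₂‖⁻¹ • (t₁ - t₂)‖ = 1 := by
    rw [norm_smul, norm_inv, norm_norm, inv_mul_cancel₀ hpos.ne']
  have hau : (‖t₁ - t₂‖ / 2) • (‖t₁ - t₂‖⁻¹ • (t₁ - t₂)) = (1 / 2 : ℝ) • (t₁ - t₂) := by
    rw [smul_smul]
    congr 1
    field_simp
  have key := norm_sub_le_of_two_mul_le_angle (v := s - (1 / 2 : ℝ) • (t₁ + t₂))
    (z := t - (1 / 2 : ℝ) • (t₁ + t₂)) (a := ‖t₁ - t₂‖ / 2) (α := π / 3 - ε / 2) (D := D) hu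
    (by linarith) (by linarith) (by linarith) (by linarith)
    (by rw [hau]; exact (congrArg norm (by module)).trans_le hd1)
    (by rw [hau]; exact (congrArg norm (by module)).trans_le hd2)
    (by
      rw [hau]
      refine (le_of_eq (by ring)).trans (hang.trans_eq ?_)
      congr 1 <;> module)
  rwa [sub_sub_sub_cancel_right, sub_sub_cancel, ← mul_div_assoc] at key

end
end

section
/- Let d ≥ 2, let 0 < ε < 2π/3, let n ≥ 2, and set A = cos(ε/2)/sin(π/3 − ε/2) and B = 1/sin(π/3 − ε/2) (note A > 1). Then every full ε-approximate Steiner tree T on n terminals in ℝ^d whose terminal set has diameter D satisfies L(T) ≤ (A^{n−2} + (A^{n−2} − 1)·B/(A − 1))·D. Consequently, since every tree connecting the terminals has length at least D, F_d(ε,n) ≤ A^{n−2} + (A^{n−2} − 1)·B/(A − 1) − 1. -/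
open Real

noncomputable section

section InnerProduct

variable {E : Type*} [NormedAddCommGroup E] [InnerProductSpace ℝ E]

theorem sin_mul_norm_add_norm_le {α : ℝ} {u v : E} (hα : 0 ≤ α)
    (h : 2 * α ≤ InnerProductGeometry.angle u v) :
    sin α * (‖u‖ + ‖v‖) ≤ ‖u - v‖ := by
  have hcos : cos (InnerProductGeometry.angle u v) ≤ cos (2 * α) :=
    cos_le_cos_of_nonneg_of_le_pi (by linarith) (InnerProductGeometry.angle_le_pi u v) h
  have hinner := InnerProductGeometry.cos_angle_mul_norm_mul_norm u v
  have hle : inner ℝ u v ≤ cos (2 * α) * (‖u‖ * ‖v‖) := by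
    rw [← hinner]; gcongr
  rw [cos_two_mul'] at hle
  have hsq := norm_sub_sq_real u v
  have h1 := sin_sq_add_cos_sq α
  refine le_of_sq_le_sq ?_ (norm_nonneg _)
  nlinarith [mul_nonneg (sq_nonneg (cos α)) (sq_nonneg (‖u‖ - ‖v‖))]

theorem sin_mul_norm_le_of_norm_sub_le {α D : ℝ} {u v w : E} (hα : 0 < α) (hα' : α ≤ π / 3)
    (h : sin α * (‖u‖ + ‖v‖) ≤ ‖u - v‖) (huv : ‖u - v‖ ≤ D) (hu : ‖w - u‖ ≤ D)
    (hv : ‖w - v‖ ≤ D) :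
    sin α * ‖w‖ ≤ cos (π / 3 - α) * D := by
  have hs : 0 < sin α := sin_pos_of_pos_of_lt_pi hα (by linarith [pi_pos])
  have hD : 0 ≤ D := (norm_nonneg _).trans hu
  have hr : √3 * √3 = 3 := mul_self_sqrt (by norm_num)
  have hr0 : 0 < √3 := by positivity
  have hcs : sin α ≤ √3 * cos α := by
    have : 0 ≤ sin (π / 3 - α) :=
      sin_nonneg_of_nonneg_of_le_pi (by linarith) (by linarith [pi_pos])
    rw [sin_sub, sin_pi_div_three, cos_pi_div_three] at this
    linarith
  have hc : 0 < cos α := cos_pos_of_mem_Ioo ⟨by linarith [pi_pos], by linarith [pi_pos]⟩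
  have h1 := sin_sq_add_cos_sq α
  rw [cos_sub, sin_pi_div_three, cos_pi_div_three]
  set p := ‖u‖ with hp
  set q := ‖v‖ with hq
  set c := ‖u - v‖ with hcdef
  have hp0 : 0 ≤ p := norm_nonneg _
  have hq0 : 0 ≤ q := norm_nonneg _
  have hc0 : 0 ≤ c := norm_nonneg _
  rcases (add_nonneg hp0 hq0).eq_or_lt with h0 | ht
  · have : u = 0 := norm_eq_zero.1 (by linarith)
    subst this
    rw [sub_zero] at hu
    nlinarith [mul_le_mul_of_nonneg_left hu hs.le, mul_nonneg hs.le hD,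
      mul_le_mul_of_nonneg_left hcs hr0.le, mul_le_mul_of_nonneg_right hcs hD]
  set t := p + q with htdef
  set y := √(p * q) * c with hy
  have hy0 : 0 ≤ y := by positivity
  have hy2 : y ^ 2 = p * q * c ^ 2 := by rw [hy, mul_pow, sq_sqrt (by positivity)]
  have hyD : y ≤ t * D / 2 := by
    have : √(p * q) ≤ t / 2 := by
      refine sqrt_le_iff.2 ⟨by positivity, ?_⟩
      nlinarith [sq_nonneg (p - q)]
    calc y ≤ t / 2 * D := by rw [hy]; gcongr
      _ = _ := by ring
  have hM : sin α * ‖q • u + p • v‖ ≤ cos α * y := by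
    refine le_of_sq_le_sq ?_ (by positivity)
    have e : ‖q • u + p • v‖ ^ 2 = p * q * (t ^ 2 - c ^ 2) := by
      rw [norm_add_sq_real, hcdef, norm_sub_sq_real, norm_smul, norm_smul, real_inner_smul_left,
        real_inner_smul_right, ← hp, ← hq, norm_of_nonneg hp0, norm_of_nonneg hq0]
      ring
    have h2 : (sin α * t) ^ 2 ≤ c ^ 2 := by gcongr
    rw [mul_pow, mul_pow, e, hy2]
    nlinarith [mul_le_mul_of_nonneg_left h2 (mul_nonneg hp0 hq0)]
  set N := ‖q • (w - u) + p • (w - v)‖ with hN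
  have hN2 : N ^ 2 ≤ (t * D) ^ 2 - y ^ 2 := by
    have e : N ^ 2 = t * q * ‖w - u‖ ^ 2 + t * p * ‖w - v‖ ^ 2 - p * q * c ^ 2 := by
      have e1 : u - v = (w - v) - (w - u) := by abel
      rw [hN, hcdef, e1, norm_add_sq_real, norm_sub_sq_real (w - v), norm_smul, norm_smul,
        real_inner_smul_left, real_inner_smul_right, norm_of_nonneg hp0, norm_of_nonneg hq0,
        real_inner_comm (w - v) (w - u), htdef]
      ring
    have h3 : ‖w - u‖ ^ 2 ≤ D ^ 2 := by gcongr
    have h4 : ‖w - v‖ ^ 2 ≤ D ^ 2 := by gcongr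
    rw [e, hy2]
    nlinarith [mul_le_mul_of_nonneg_left h3 (mul_nonneg ht.le hq0),
      mul_le_mul_of_nonneg_left h4 (mul_nonneg ht.le hp0)]
  have hNle : √3 * N ≤ 2 * (t * D) - y := by
    have hH : 0 ≤ t * D := mul_nonneg ht.le hD
    refine le_of_sq_le_sq ?_ (by linarith)
    rw [mul_pow, sq_sqrt (by norm_num)]
    linarith [sq_nonneg (t * D - 2 * y)]
  have hw : t * ‖w‖ ≤ ‖q • u + p • v‖ + N := by
    have e : t • w = (q • u + p • v) + (q • (w - u) + p • (w - v)) := by rw [htdef]; module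
    calc t * ‖w‖ = ‖t • w‖ := by rw [norm_smul, norm_of_nonneg ht.le]
      _ ≤ _ := by rw [e]; exact norm_add_le _ _
  have hN' : sin α * N ≤ sin α * (√3 * (2 * (t * D) - y) / 3) := by
    gcongr
    linarith [mul_le_mul_of_nonneg_left hNle hr0.le, congrArg (· * N) hr]
  have hprod : 0 ≤ √3 * ((√3 * cos α - sin α) * (t * D / 2 - y)) :=
    mul_nonneg hr0.le (mul_nonneg (sub_nonneg.2 hcs) (sub_nonneg.2 hyD))
  have hprod' : √3 * ((√3 * cos α - sin α) * (t * D / 2 - y)) =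
      3 * (cos α * (t * D / 2 - y)) - √3 * sin α * (t * D / 2 - y) := by
    linear_combination cos α * (t * D / 2 - y) * hr
  refine le_of_mul_le_mul_left (?_ : t * _ ≤ t * _) ht
  linarith [mul_le_mul_of_nonneg_left hw hs.le]

end InnerProduct

section Graph

variable {V : Type} {E : Type*}

open Classical in
/-- The total edge length of the realization `pos` of a finite graph. -/
noncomputable def graphLength [Fintype V] [PseudoMetricSpace E] (G : SimpleGraph V)
    (pos : V → E) : ℝ :=
  (1 / 2) * ∑ u, ∑ v, if G.Adj u v then dist (pos u) (pos v) else 0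

theorem ncard_neighborSet_induce_compl_singleton (G : SimpleGraph V) (a : V)
    (v : ({a}ᶜ : Set V)) :
    ((G.induce {a}ᶜ).neighborSet v).ncard = (G.neighborSet v \ {a}).ncard := by
  rw [← Set.ncard_image_of_injective _ Subtype.val_injective]
  congr 1
  ext x
  simp [and_comm]

theorem graphLength_eq_induce_add [Fintype V] [PseudoMetricSpace E] (G : SimpleGraph V)
    (pos : V → E) {a s : V} (h : G.neighborSet a = {s}) [Fintype ({a}ᶜ : Set V)] :
    graphLength G pos =
      graphLength (G.induce {a}ᶜ) (fun v => pos v) + dist (pos a) (pos s) := by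
  classical
  have hadj : ∀ v, G.Adj a v ↔ v = s := fun v => by
    rw [← SimpleGraph.mem_neighborSet, h, Set.mem_singleton_iff]
  have hsum : ∀ f : V → ℝ, ∑ v, f v = f a + ∑ v : ({a}ᶜ : Set V), f v := fun f => by
    rw [← Finset.add_sum_erase _ f (Finset.mem_univ a), Finset.sum_subtype (p := (· ∈ ({a}ᶜ : Set V))) _ (by simp) f]
  have hs : s ∈ ({a}ᶜ : Set V) := ((hadj s).2 rfl).ne'
  have hrow : ∑ v, (if G.Adj a v then dist (pos a) (pos v) else 0) = dist (pos a) (pos s) := by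
    simp [hadj]
  have hcol : ∑ u : ({a}ᶜ : Set V), (if G.Adj u a then dist (pos u) (pos a) else 0) =
      dist (pos a) (pos s) := by
    rw [Finset.sum_eq_single ⟨s, hs⟩]
    · simp [G.adj_comm s a, hadj, dist_comm]
    · intro b _ hb
      rw [if_neg]
      rw [G.adj_comm, hadj]
      exact fun h => hb (Subtype.ext h)
    · simp
  unfold graphLength
  rw [hsum, hrow]
  simp_rw [hsum (fun v => if G.Adj _ v then dist (pos _) (pos v) else 0)]
  rw [Finset.sum_add_distrib, hcol]
  simp only [SimpleGraph.comap_adj, Function.Embedding.subtype_apply]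
  ring

theorem dist_le_sum_of_isPath [PseudoMetricSpace E] [DecidableEq V] (G : SimpleGraph V)
    [DecidableRel G.Adj] (pos : V → E) {u v : V} (p : G.Walk u v) (hp : p.IsPath) :
    2 * dist (pos u) (pos v) ≤ ∑ x ∈ p.support.toFinset, ∑ y ∈ p.support.toFinset,
      if G.Adj x y then dist (pos x) (pos y) else 0 := by
  induction p with
  | nil => simp
  | @cons u v w h p ih =>
    rw [SimpleGraph.Walk.cons_isPath_iff] at hp
    have hnn : ∀ x y, 0 ≤ if G.Adj x y then dist (pos x) (pos y) else 0 := fun x y => by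
      split_ifs <;> positivity
    have hu : u ∉ p.support.toFinset := by simpa using hp.2
    have hv : v ∈ p.support.toFinset := by simp
    rw [SimpleGraph.Walk.support_cons, List.toFinset_cons, Finset.sum_insert hu]
    simp_rw [Finset.sum_insert hu]
    rw [Finset.sum_add_distrib]
    have h1 := Finset.single_le_sum (f := fun y => if G.Adj u y then dist (pos u) (pos y) else 0)
      (fun y _ => hnn u y) hv
    have h2 := Finset.single_le_sum (f := fun y => if G.Adj y u then dist (pos y) (pos u) else 0)
      (fun y _ => hnn y u) hv
    simp only [h, h.symm, if_true, dist_comm (pos v)] at h1 h2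
    linarith [ih hp.1, hnn u u, dist_triangle (pos u) (pos v) (pos w)]

theorem dist_le_graphLength [Fintype V] [PseudoMetricSpace E] {G : SimpleGraph V}
    (hG : G.Connected) (pos : V → E) (u v : V) : dist (pos u) (pos v) ≤ graphLength G pos := by
  classical
  obtain ⟨p, hp⟩ := hG.exists_isPath u v
  have hnn : ∀ x y, 0 ≤ if G.Adj x y then dist (pos x) (pos y) else 0 := fun x y => by
    split_ifs <;> positivity
  have h1 := dist_le_sum_of_isPath G pos p hp
  have h2 : ∑ x ∈ p.support.toFinset, ∑ y ∈ p.support.toFinset,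
      (if G.Adj x y then dist (pos x) (pos y) else 0) ≤
      ∑ x, ∑ y, if G.Adj x y then dist (pos x) (pos y) else 0 :=
    (Finset.sum_le_sum fun x _ => Finset.sum_le_univ_sum_of_nonneg (hnn x)).trans
      (Finset.sum_le_univ_sum_of_nonneg fun x => Finset.sum_nonneg fun y _ => hnn x y)
  unfold graphLength
  linarith

theorem exists_pair_of_leaves [Fintype V] [DecidableEq V] {G : SimpleGraph V} (hG : G.Connected)
    (I : Finset V) (hI : 0 < I.card) (hcard : Fintype.card V = 2 * I.card + 2)
    (hleaf : ∀ v ∉ I, (G.neighborSet v).ncard = 1) :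
    ∃ s ∈ I, ∃ a ∉ I, ∃ b ∉ I, a ≠ b ∧ G.neighborSet a = {s} ∧ G.neighborSet b = {s} := by
  have hex : ∀ v, ∃ s, v ∉ I → G.neighborSet v = {s} := fun v => by
    by_cases hv : v ∈ I
    · exact ⟨v, fun h => (h hv).elim⟩
    · obtain ⟨s, hs⟩ := Set.ncard_eq_one.1 (hleaf v hv)
      exact ⟨s, fun _ => hs⟩
  choose f hf using hex
  have hmem : ∀ v ∈ Iᶜ, f v ∈ I := by
    intro v hv
    rw [Finset.mem_compl] at hv
    by_contra hfv
    have hvf : G.Adj v (f v) := by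
      rw [← SimpleGraph.mem_neighborSet, hf v hv]; rfl
    have hff : f (f v) = v := by
      have : v ∈ G.neighborSet (f v) := hvf.symm
      rw [hf _ hfv] at this
      exact this.symm
    have hall : ∀ x, x = v ∨ x = f v := by
      intro x
      have := (SimpleGraph.reachable_iff_reflTransGen v x).1 (hG.preconnected v x)
      induction this with
      | refl => exact Or.inl rfl
      | @tail y z _ hyz ih =>
        rw [← SimpleGraph.mem_neighborSet] at hyz
        rcases ih with rfl | rfl
        · rw [hf _ hv] at hyz; exact Or.inr hyz
        · rw [hf _ hfv, hff] at hyz; exact Or.inl hyz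
    have : Fintype.card V ≤ 2 := by
      rw [← Finset.card_univ]
      exact (Finset.card_le_card fun x _ => by simpa using hall x).trans
        (Finset.card_le_two (a := v) (b := f v))
    omega
  obtain ⟨a, ha, b, hb, hab, he⟩ := Finset.exists_ne_map_eq_of_card_lt_of_maps_to
    (by rw [Finset.card_compl]; omega) hmem
  refine ⟨f a, hmem a ha, a, by simpa using ha, b, by simpa using hb, hab,
    hf a (by simpa using ha), ?_⟩
  rw [he]
  exact hf b (by simpa using hb)

theorem graphLength_le_of_card_eq_two [Fintype V] [PseudoMetricSpace E] (G : SimpleGraph V)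
    (pos : V → E) {D : ℝ} (hcard : Fintype.card V = 2)
    (hleaf : ∀ v, (G.neighborSet v).ncard = 1) (hD : ∀ u v, dist (pos u) (pos v) ≤ D) :
    graphLength G pos ≤ D := by
  classical
  obtain ⟨a⟩ : Nonempty V := Fintype.card_pos_iff.1 (by omega)
  obtain ⟨s, hs⟩ := Set.ncard_eq_one.1 (hleaf a)
  have : Subsingleton ({a}ᶜ : Set V) := by
    rw [← Fintype.card_le_one_iff_subsingleton, Fintype.card_compl_set]
    simp [hcard]
  rw [graphLength_eq_induce_add G pos hs]
  have h0 : graphLength (G.induce {a}ᶜ) (fun v => pos v) = 0 := by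
    unfold graphLength
    have : ∀ u v : ({a}ᶜ : Set V), ¬ (G.induce {a}ᶜ).Adj u v := fun u v h =>
      h.ne (Subsingleton.elim u v)
    simp only [this, if_false, Finset.sum_const_zero, mul_zero]
  rw [h0, zero_add]
  exact hD a s

theorem connected_induce_compl_singleton [Finite V] {G : SimpleGraph V} (hG : G.Connected)
    {a s : V} (h : G.neighborSet a = {s}) : (G.induce {a}ᶜ).Connected := by
  classical
  have := Fintype.ofFinite V
  refine hG.induce_compl_singleton_of_degree_eq_one (v := a) ?_
  rw [← SimpleGraph.card_neighborSet_eq_degree, ← Set.toFinset_card, ← Set.ncard_eq_toFinset_card',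
    h, Set.ncard_singleton]

theorem graphLength_le_of_angle_ge [NormedAddCommGroup E] [InnerProductSpace ℝ E] {α A B : ℝ}
    (hα : 0 < α) (hα' : α ≤ π / 3) (hA1 : 1 < A) (hA : sin α * A = cos (π / 3 - α))
    (hB : sin α * B = 1) (m : ℕ) :
    ∀ (V : Type) [Fintype V] (G : SimpleGraph V) (I : Finset V) (pos : V → E) (D : ℝ),
      G.Connected → I.card = m → Fintype.card V = 2 * m + 2 →
      (∀ v ∉ I, (G.neighborSet v).ncard = 1) → (∀ v ∈ I, (G.neighborSet v).ncard = 3) →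
      (∀ s ∈ I, ∀ u v, G.Adj s u → G.Adj s v → u ≠ v →
        2 * α ≤ InnerProductGeometry.angle (pos u - pos s) (pos v - pos s)) →
      (∀ u ∉ I, ∀ v ∉ I, dist (pos u) (pos v) ≤ D) →
      graphLength G pos ≤ (A ^ m + (A ^ m - 1) * B / (A - 1)) * D := by
  classical
  have hsin : 0 < sin α := sin_pos_of_pos_of_lt_pi hα (by linarith [pi_pos])
  induction m with
  | zero =>
    intro V _ G I pos D _ hI hcard hleaf _ _ hD
    obtain rfl := Finset.card_eq_zero.1 hI
    simpa using graphLength_le_of_card_eq_two G pos (by omega)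
      (fun v => hleaf v (by simp)) (fun u v => hD u (by simp) v (by simp))
  | succ m ih =>
    intro V _ G I pos D hG hI hcard hleaf hint hangle hD
    obtain ⟨s, hs, a, ha, b, hb, hab, hNa, hNb⟩ :=
      exists_pair_of_leaves hG I (by omega) (by omega) hleaf
    have hsa : s ≠ a := fun h => ha (h ▸ hs)
    have hsb : s ≠ b := fun h => hb (h ▸ hs)
    have hadja : G.Adj s a := by
      rw [G.adj_comm, ← SimpleGraph.mem_neighborSet, hNa]; rfl
    have hadjb : G.Adj s b := by
      rw [G.adj_comm, ← SimpleGraph.mem_neighborSet, hNb]; rfl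
    have hna : ∀ v, v ≠ s → a ∉ G.neighborSet v := fun v hv h => hv (by
      have : v ∈ G.neighborSet a := G.adj_symm h
      rwa [hNa] at this)
    have hnb : ∀ v, v ≠ s → b ∉ G.neighborSet v := fun v hv h => hv (by
      have : v ∈ G.neighborSet b := G.adj_symm h
      rwa [hNb] at this)
    have hD0 : 0 ≤ D := dist_nonneg.trans (hD a ha b hb)
    have hsum : sin α * (dist (pos a) (pos s) + dist (pos b) (pos s)) ≤ dist (pos a) (pos b) := by
      have := sin_mul_norm_add_norm_le hα.le (hangle s hs a b hadja hadjb hab)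
      rw [sub_sub_sub_cancel_right] at this
      simpa only [dist_eq_norm] using this
    have hfar : ∀ x ∉ I, dist (pos x) (pos s) ≤ A * D := by
      intro x hx
      have h1 := hD a ha b hb
      have h2 := hD x hx a ha
      have h3 := hD x hx b hb
      rw [dist_eq_norm] at h1 h2 h3
      have := sin_mul_norm_le_of_norm_sub_le (u := pos a - pos s) (v := pos b - pos s)
        (w := pos x - pos s) (D := D) hα hα' (by simpa [dist_eq_norm] using hsum)
        (by simpa using h1) (by simpa using h2) (by simpa using h3)
      rw [← hA, mul_assoc, ← dist_eq_norm] at this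
      exact le_of_mul_le_mul_left this hsin
    -- prune the two leaves, which turns `s` into a leaf
    set G₁ := G.induce {a}ᶜ with hG₁
    let b₁ : ({a}ᶜ : Set V) := ⟨b, hab.symm⟩
    let s₁ : ({a}ᶜ : Set V) := ⟨s, hsa⟩
    have hNb₁ : G₁.neighborSet b₁ = {s₁} := by
      ext x
      have : (x : V) ∈ G.neighborSet b ↔ (x : V) = s := by rw [hNb]; rfl
      rw [Set.mem_singleton_iff, Subtype.ext_iff, ← this]
      rfl
    set G₂ := G₁.induce {b₁}ᶜ with hG₂
    let J : Finset ({b₁}ᶜ : Set ({a}ᶜ : Set V)) :=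
      Finset.univ.filter fun v => (v : V) ∈ I ∧ (v : V) ≠ s
    have hJ : ∀ v : ({b₁}ᶜ : Set ({a}ᶜ : Set V)), v ∈ J ↔ (v : V) ∈ I ∧ (v : V) ≠ s :=
      fun v => by simp [J]
    have hmemJ : ∀ v : ({b₁}ᶜ : Set ({a}ᶜ : Set V)), v ∉ J → (v : V) = s ∨ (v : V) ∉ I := by
      intro v hv
      rw [hJ] at hv
      tauto
    have hncard : ∀ v : ({b₁}ᶜ : Set ({a}ᶜ : Set V)), (v : V) ≠ s →
        (G₂.neighborSet v).ncard = (G.neighborSet (v : V)).ncard := by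
      intro v hv
      rw [hG₂, ncard_neighborSet_induce_compl_singleton,
        Set.sdiff_singleton_eq_self (show b₁ ∉ G₁.neighborSet v from hnb v hv), hG₁,
        ncard_neighborSet_induce_compl_singleton, Set.sdiff_singleton_eq_self (hna v hv)]
    have hncard_s : ∀ v : ({b₁}ᶜ : Set ({a}ᶜ : Set V)), (v : V) = s →
        (G₂.neighborSet v).ncard = 1 := by
      intro v hv
      have hb₁ : b₁ ∈ G₁.neighborSet v := by
        change G.Adj v b
        rwa [hv]
      have ha₁ : a ∈ G.neighborSet (v : V) := by rw [hv]; exact hadja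
      have h3 := hint s hs
      rw [← hv] at h3
      rw [hG₂, ncard_neighborSet_induce_compl_singleton, Set.ncard_sdiff_singleton_of_mem hb₁, hG₁,
        ncard_neighborSet_induce_compl_singleton, Set.ncard_sdiff_singleton_of_mem ha₁, h3]
    have hJcard : J.card = m := by
      have : J.image (Subtype.val ∘ Subtype.val) = I.erase s := by
        ext x
        simp only [Finset.mem_image, hJ, Finset.mem_erase, Function.comp_apply]
        constructor
        · rintro ⟨v, ⟨h1, h2⟩, rfl⟩
          exact ⟨h2, h1⟩
        · rintro ⟨h1, h2⟩
          have hxa : x ≠ a := fun h => ha (h ▸ h2)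
          have hxb : x ≠ b := fun h => hb (h ▸ h2)
          exact ⟨⟨⟨x, hxa⟩, fun h => hxb (congrArg Subtype.val h)⟩, ⟨h2, h1⟩, rfl⟩
      rw [← Finset.card_image_of_injective J
        (Subtype.val_injective.comp Subtype.val_injective), this,
        Finset.card_erase_of_mem hs, hI]
      rfl
    have hVcard : Fintype.card ({b₁}ᶜ : Set ({a}ᶜ : Set V)) = 2 * m + 2 := by
      rw [Fintype.card_compl_set, Fintype.card_compl_set, hcard]
      simp
      omega
    have hrec := ih ({b₁}ᶜ : Set ({a}ᶜ : Set V)) G₂ J (fun v => pos v) (A * D)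
      (connected_induce_compl_singleton (connected_induce_compl_singleton hG hNa) hNb₁)
      hJcard hVcard
      (fun v hv => by
        by_cases hvs : (v : V) = s
        · exact hncard_s v hvs
        · rw [hncard v hvs]
          exact hleaf v ((hmemJ v hv).resolve_left hvs))
      (fun v hv => by
        rw [hJ] at hv
        rw [hncard v hv.2]
        exact hint v hv.1)
      (fun t ht u v hu hv huv => hangle t ((hJ t).1 ht).1 u v hu hv
        fun h => huv (Subtype.ext (Subtype.ext h)))
      (fun u hu v hv => by
        have hAD : D ≤ A * D := le_mul_of_one_le_left hD0 hA1.le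
        rcases hmemJ u hu with hu | hu <;> rcases hmemJ v hv with hv | hv
        · rw [hu, hv, dist_self]; linarith
        · rw [hu, dist_comm]; exact hfar v hv
        · rw [hv]; exact hfar u hu
        · exact (hD u hu v hv).trans hAD)
    rw [graphLength_eq_induce_add G pos hNa,
      graphLength_eq_induce_add G₁ (fun v => pos v) hNb₁]
    have hpair : dist (pos a) (pos s) + dist (pos b) (pos s) ≤ B * D := by
      refine le_of_mul_le_mul_left ?_ hsin
      rw [← mul_assoc, hB, one_mul]
      exact hsum.trans (hD a ha b hb)
    have hC : (A ^ (m + 1) + (A ^ (m + 1) - 1) * B / (A - 1)) * D =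
        (A ^ m + (A ^ m - 1) * B / (A - 1)) * (A * D) + B * D := by
      have : A - 1 ≠ 0 := by linarith
      field_simp
      ring
    rw [hC]
    change graphLength G₂ (fun v => pos v) + dist (pos b) (pos s) + _ ≤ _
    linarith

end Graph

/-- For `d ≥ 2`, `0 < ε < 2π/3`, `n ≥ 2`, `A = cos(ε/2)/sin(π/3 - ε/2)` and
`B = 1/sin(π/3 - ε/2)`: every full `ε`-approximate Steiner tree on `n` terminals in
`ℝ^d` whose terminal set has diameter `D` has length at most
`(A^(n-2) + (A^(n-2) - 1)·B/(A-1))·D`, and consequently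
`F_d(ε,n) ≤ A^(n-2) + (A^(n-2) - 1)·B/(A-1) - 1`. -/
theorem steiner_exponential_upper_bound (d : ℕ) (hd : 2 ≤ d)
    (ε : ℝ) (hε0 : 0 < ε) (hε : ε < 2 * π / 3) (n : ℕ) (hn : 2 ≤ n)
    (A B : ℝ) (hA : A = Real.cos (ε / 2) / Real.sin (π / 3 - ε / 2))
    (hB : B = 1 / Real.sin (π / 3 - ε / 2)) :
    (∀ (G : FullSteinerTopology n) (pos : SteinerVert n → Epc d),
      IsApproxSteiner ε G pos →
      ∀ D : ℝ, D = Metric.diam (Set.range fun t : Fin n => pos (Sum.inl t)) →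
        treeLength G pos ≤ (A ^ (n - 2) + (A ^ (n - 2) - 1) * B / (A - 1)) * D) ∧
    steinerF d ε n ≤ A ^ (n - 2) + (A ^ (n - 2) - 1) * B / (A - 1) - 1 := by
  have hpi := pi_pos
  set α := π / 3 - ε / 2 with hα
  have hα0 : 0 < α := by linarith
  have hα1 : α < π / 3 := by linarith
  have hsin : 0 < sin α := sin_pos_of_pos_of_lt_pi hα0 (by linarith)
  have hAα : sin α * A = cos (π / 3 - α) := by
    rw [hA, mul_div_cancel₀ _ hsin.ne', hα]
    congr 1
    ring
  have hBα : sin α * B = 1 := by rw [hB, mul_one_div_cancel hsin.ne']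
  have hA1 : 1 < A := by
    rw [hA, one_lt_div hsin, ← cos_pi_div_two_sub]
    exact cos_lt_cos_of_nonneg_of_le_pi_div_two (by linarith) (by linarith) (by linarith)
  have hB0 : 0 < B := by rw [hB]; positivity
  have hC1 : 0 ≤ A ^ (n - 2) + (A ^ (n - 2) - 1) * B / (A - 1) - 1 := by
    have h1 := one_le_pow₀ hA1.le (n := n - 2)
    have : 0 ≤ (A ^ (n - 2) - 1) * B / (A - 1) :=
      div_nonneg (mul_nonneg (by linarith) hB0.le) (by linarith)
    linarith
  have hC : 0 ≤ A ^ (n - 2) + (A ^ (n - 2) - 1) * B / (A - 1) := by linarith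
  have hlen : ∀ (G : FullSteinerTopology n) (pos : SteinerVert n → Epc d),
      treeLength G pos = graphLength G.graph pos := fun _ _ => rfl
  have hmain : ∀ (G : FullSteinerTopology n) (pos : SteinerVert n → Epc d),
      IsApproxSteiner ε G pos →
      ∀ D : ℝ, D = Metric.diam (Set.range fun t : Fin n => pos (Sum.inl t)) →
        treeLength G pos ≤ (A ^ (n - 2) + (A ^ (n - 2) - 1) * B / (A - 1)) * D := by
    intro G pos hG D hD
    rw [hlen]
    refine graphLength_le_of_angle_ge hα0 hα1.le hA1 hAα hBα (n - 2) (SteinerVert n) G.graph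
      (Finset.univ.map Function.Embedding.inr) pos D G.isTree.connected (by simp) (by simp; omega)
      ?_ ?_ ?_ ?_
    · rintro (t | s) h
      · exact G.degTerminal t
      · simp at h
    · rintro (t | s) h
      · simp at h
      · exact G.degSteiner s
    · rintro (t | s) h u v hu hv huv
      · simp at h
      · have := (abs_le.1 (hG s u v hu hv huv)).1
        rw [EuclideanGeometry.angle, vsub_eq_sub, vsub_eq_sub] at this
        linarith
    · rintro (u | u) hu (v | v) hv
      · rw [hD]
        exact Metric.dist_le_diam_of_mem (Set.finite_range _).isBounded ⟨u, rfl⟩ ⟨v, rfl⟩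
      all_goals simp at hu hv
  refine ⟨hmain, ?_⟩
  refine Real.sSup_le ?_ hC1
  rintro r ⟨G, pos, hG, rfl⟩
  have hdiam : Metric.diam (Set.range fun t : Fin n => pos (Sum.inl t)) ≤ minTreeLength G pos := by
    refine le_csInf ⟨_, pos, fun _ => rfl, rfl⟩ ?_
    rintro L ⟨pos', hpos', rfl⟩
    have hdist := dist_le_graphLength G.isTree.connected pos'
    have t : SteinerVert n := Sum.inl ⟨0, by omega⟩
    refine Metric.diam_le_of_forall_dist_le (dist_nonneg.trans (hdist t t)) ?_
    rintro _ ⟨u, rfl⟩ _ ⟨v, rfl⟩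
    simpa only [hpos', hlen] using hdist (Sum.inl u) (Sum.inl v)
  have hmin : 0 ≤ minTreeLength G pos := Metric.diam_nonneg.trans hdiam
  refine sub_le_sub_right (div_le_of_le_mul₀ hmin hC ?_) 1
  exact (hmain G pos hG _ rfl).trans (mul_le_mul_of_nonneg_left hdiam hC)

end
end

section
/- Let a, b, c ∈ ℝ^d (d ≥ 2) be the vertices of an equilateral triangle, i.e. ‖a−b‖ = ‖b−c‖ = ‖c−a‖ > 0. Then for every x ∈ ℝ^d, ‖x − a‖ ≤ ‖x − b‖ + ‖x − c‖, and equality holds if and only if x lies on the minor arc with endpoints b and c of the circumcircle of the triangle, i.e. x lies in the plane through a, b, c, its distance to the circumcenter of the triangle equals the circumradius, and x lies on the closed side of the line bc not containing a. -/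
open Real

noncomputable section

section EquilateralPair

variable {V : Type*} [NormedAddCommGroup V] [InnerProductSpace ℝ V]

/-- Two vectors spanning an equilateral triangle of side `‖e‖` have inner product `‖e‖ ^ 2 / 2`. -/
lemma inner_eq_half_of_norm_sub_eq {e f : V} (hf : ‖f‖ = ‖e‖) (hef : ‖e - f‖ = ‖e‖) :
    inner ℝ e f = ‖e‖ ^ 2 / 2 := by
  have h := norm_sub_sq_real e f
  rw [hf, hef] at h
  linarith

lemma norm_sub_smul_add_smul_sq {e f : V} (hf : ‖f‖ = ‖e‖) (hef : ‖e - f‖ = ‖e‖)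
    (y : V) (p q : ℝ) :
    ‖y - (p • e + q • f)‖ ^ 2 = ‖y‖ ^ 2 - 2 * (p * inner ℝ y e + q * inner ℝ y f)
      + (p ^ 2 + p * q + q ^ 2) * ‖e‖ ^ 2 := by
  rw [norm_sub_sq_real, norm_add_sq_real, inner_add_right]
  simp only [inner_smul_left, inner_smul_right, norm_smul, mul_pow, Real.norm_eq_abs, sq_abs,
    inner_eq_half_of_norm_sub_eq hf hef, hf, RCLike.conj_to_real]
  ring

/-- The quantity controlling `‖y‖ ≤ ‖y - e‖ + ‖y - f‖` is a sum of two squares: one vanishes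
on the sphere through `0`, `e`, `f` centred in their plane, the other on that plane. -/
lemma four_mul_sq_mul_sq_sub_sq {e f : V} (hf : ‖f‖ = ‖e‖) (hef : ‖e - f‖ = ‖e‖)
    (he : 0 < ‖e‖) (y : V) :
    ∃ p q : ℝ, inner ℝ y e + inner ℝ y f = 3 / 2 * (p + q) * ‖e‖ ^ 2 ∧
      4 * (‖y - e‖ ^ 2 * ‖y - f‖ ^ 2) - (‖y‖ ^ 2 - ‖y - e‖ ^ 2 - ‖y - f‖ ^ 2) ^ 2 =
        (3 * ‖y‖ ^ 2 - 2 * (inner ℝ y e + inner ℝ y f)) ^ 2 / 3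
          + 4 * ‖e‖ ^ 2 * ‖y - (p • e + q • f)‖ ^ 2 := by
  have he' : ‖e‖ ≠ 0 := he.ne'
  refine ⟨2 / 3 * (2 * inner ℝ y e - inner ℝ y f) / ‖e‖ ^ 2,
    2 / 3 * (2 * inner ℝ y f - inner ℝ y e) / ‖e‖ ^ 2, ?_, ?_⟩
  · field_simp
    ring
  · rw [norm_sub_smul_add_smul_sq hf hef, norm_sub_sq_real y e, norm_sub_sq_real y f, hf]
    field_simp
    ring

lemma norm_le_norm_sub_add_norm_sub {e f : V} (hf : ‖f‖ = ‖e‖) (hef : ‖e - f‖ = ‖e‖)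
    (he : 0 < ‖e‖) (y : V) : ‖y‖ ≤ ‖y - e‖ + ‖y - f‖ := by
  obtain ⟨p, q, -, h⟩ := four_mul_sq_mul_sq_sub_sq hf hef he y
  have hle : ‖y‖ ^ 2 - ‖y - e‖ ^ 2 - ‖y - f‖ ^ 2 ≤ 2 * (‖y - e‖ * ‖y - f‖) := by
    refine abs_le_of_sq_le_sq' ?_ (by positivity) |>.2
    have : 0 ≤ (3 * ‖y‖ ^ 2 - 2 * (inner ℝ y e + inner ℝ y f)) ^ 2 / 3
        + 4 * ‖e‖ ^ 2 * ‖y - (p • e + q • f)‖ ^ 2 := by positivity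
    linarith [mul_pow 2 (‖y - e‖ * ‖y - f‖) 2, mul_pow ‖y - e‖ ‖y - f‖ 2]
  rw [← sq_le_sq₀ (norm_nonneg _) (by positivity)]
  linarith [add_sq ‖y - e‖ ‖y - f‖]

lemma norm_sub_third_eq_iff {e f : V} (hf : ‖f‖ = ‖e‖) (hef : ‖e - f‖ = ‖e‖) (y : V) :
    ‖y - (3 : ℝ)⁻¹ • (e + f)‖ = ‖(3 : ℝ)⁻¹ • (e + f)‖ ↔
      3 * ‖y‖ ^ 2 = 2 * (inner ℝ y e + inner ℝ y f) := by
  have h0 := norm_sub_smul_add_smul_sq hf hef 0 3⁻¹ 3⁻¹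
  have h := norm_sub_smul_add_smul_sq hf hef y 3⁻¹ 3⁻¹
  simp only [zero_sub, norm_neg, inner_zero_left, norm_zero, ← smul_add] at h0 h
  rw [← sq_eq_sq₀ (norm_nonneg _) (norm_nonneg _), h, h0]
  constructor <;> intro _ <;> linarith

lemma norm_eq_norm_sub_add_norm_sub_iff {e f : V} (hf : ‖f‖ = ‖e‖) (hef : ‖e - f‖ = ‖e‖)
    (he : 0 < ‖e‖) (y : V) :
    ‖y‖ = ‖y - e‖ + ‖y - f‖ ↔
      (∃ p q : ℝ, y = p • e + q • f ∧ 1 ≤ p + q) ∧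
        ‖y - (3 : ℝ)⁻¹ • (e + f)‖ = ‖(3 : ℝ)⁻¹ • (e + f)‖ := by
  rw [norm_sub_third_eq_iff hf hef]
  have hL : 0 < ‖e‖ ^ 2 := by positivity
  have hye := norm_sub_sq_real y e
  have hyf := norm_sub_sq_real y f
  rw [hf] at hyf
  have hprod : 0 ≤ ‖y - e‖ * ‖y - f‖ := by positivity
  constructor
  · intro heq
    obtain ⟨p, q, hpq, h⟩ := four_mul_sq_mul_sq_sub_sq hf hef he y
    have hE : ‖y‖ ^ 2 - ‖y - e‖ ^ 2 - ‖y - f‖ ^ 2 = 2 * (‖y - e‖ * ‖y - f‖) := by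
      rw [heq]; ring
    rw [hE] at h
    have hn : 0 ≤ 4 * ‖e‖ ^ 2 * ‖y - (p • e + q • f)‖ ^ 2 := by positivity
    have hc := sq_nonneg (3 * ‖y‖ ^ 2 - 2 * (inner ℝ y e + inner ℝ y f))
    have hn0 : 4 * ‖e‖ ^ 2 * ‖y - (p • e + q • f)‖ ^ 2 = 0 := by linarith
    have hc0 : 3 * ‖y‖ ^ 2 - 2 * (inner ℝ y e + inner ℝ y f) = 0 :=
      pow_eq_zero_iff two_ne_zero |>.1 (by linarith)
    refine ⟨⟨p, q, ?_, ?_⟩, by linarith⟩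
    · have := (mul_eq_zero.1 hn0).resolve_left (by positivity)
      exact sub_eq_zero.1 (norm_eq_zero.1 (pow_eq_zero_iff two_ne_zero |>.1 this))
    · refine le_of_mul_le_mul_right ?_ hL
      linarith
  · rintro ⟨⟨p, q, hy, hpq⟩, hc⟩
    have hin := inner_eq_half_of_norm_sub_eq hf hef
    have hye' : inner ℝ y e = (p + q / 2) * ‖e‖ ^ 2 := by
      rw [hy, inner_add_left, real_inner_smul_left, real_inner_smul_left, real_inner_comm e f, hin,
        real_inner_self_eq_norm_sq]
      ring
    have hyf' : inner ℝ y f = (p / 2 + q) * ‖e‖ ^ 2 := by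
      rw [hy, inner_add_left, real_inner_smul_left, real_inner_smul_left, hin,
        real_inner_self_eq_norm_sq, hf]
      ring
    have hyy : ‖y‖ ^ 2 = (p ^ 2 + p * q + q ^ 2) * ‖e‖ ^ 2 := by
      have := norm_sub_smul_add_smul_sq hf hef y p q
      rw [← hy, sub_self, norm_zero, hye', hyf'] at this
      linarith
    have hR : ‖y‖ ^ 2 = (p + q) * ‖e‖ ^ 2 := by linarith
    have hcirc : p ^ 2 + p * q + q ^ 2 = p + q :=
      mul_right_cancel₀ hL.ne' (hyy.symm.trans hR)
    rw [hye', hR] at hye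
    rw [hyf', hR] at hyf
    have hE : ‖y‖ ^ 2 - ‖y - e‖ ^ 2 - ‖y - f‖ ^ 2 = 2 * (‖y - e‖ * ‖y - f‖) := by
      rw [← sq_eq_sq₀ _ (by positivity)]
      · rw [mul_pow, mul_pow, hye, hyf, hR]
        linear_combination (4 * (‖e‖ ^ 2) ^ 2) * hcirc
      · rw [hye, hyf, hR]
        nlinarith
    rw [← sq_eq_sq₀ (norm_nonneg _) (by positivity)]
    linarith [add_sq ‖y - e‖ ‖y - f‖]

end EquilateralPair

/-- For an equilateral triangle `abc` in `ℝ^d` and any point `x`,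
`‖x - a‖ ≤ ‖x - b‖ + ‖x - c‖`, with equality iff `x` lies on the minor arc `bc` of the
circumcircle: `x` lies in the plane through `a, b, c` on the closed side of the line `bc`
not containing `a` (i.e. `x` is an affine combination `α•a + β•b + γ•c` with
`α + β + γ = 1` and `α ≤ 0`), and the distance from `x` to the circumcenter
`(a + b + c)/3` equals the circumradius. -/
theorem equilateral_rotation_inequality (d : ℕ) (hd : 2 ≤ d) (a b c : Epc d)
    (hab : ‖a - b‖ = ‖b - c‖) (hbc : ‖b - c‖ = ‖c - a‖) (hpos : 0 < ‖a - b‖)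
    (x : Epc d) :
    ‖x - a‖ ≤ ‖x - b‖ + ‖x - c‖ ∧
    (‖x - a‖ = ‖x - b‖ + ‖x - c‖ ↔
      (∃ α β γ : ℝ, α + β + γ = 1 ∧ x = α • a + β • b + γ • c ∧ α ≤ 0) ∧
      ‖x - (3 : ℝ)⁻¹ • (a + b + c)‖ = ‖a - (3 : ℝ)⁻¹ • (a + b + c)‖) := by
  have hf : ‖c - a‖ = ‖b - a‖ := by rw [← hbc, ← hab, norm_sub_rev]
  have hef : ‖(b - a) - (c - a)‖ = ‖b - a‖ := by
    rw [sub_sub_sub_cancel_right, ← hab, norm_sub_rev]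
  have he : 0 < ‖b - a‖ := by rwa [norm_sub_rev]
  have hle := norm_le_norm_sub_add_norm_sub hf hef he (x - a)
  have hiff := norm_eq_norm_sub_add_norm_sub_iff hf hef he (x - a)
  rw [sub_sub_sub_cancel_right, sub_sub_sub_cancel_right] at hle hiff
  refine ⟨hle, hiff.trans (and_congr ?_ ?_)⟩
  · constructor
    · rintro ⟨p, q, hx, hpq⟩
      refine ⟨1 - p - q, p, q, by ring, ?_, by linarith⟩
      rw [← sub_add_cancel x a, hx]
      module
    · rintro ⟨α, β, γ, hsum, rfl, hα⟩
      refine ⟨β, γ, ?_, by linarith⟩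
      obtain rfl : α = 1 - β - γ := by linarith
      module
  · have hx : x - a - (3 : ℝ)⁻¹ • (b - a + (c - a)) = x - (3 : ℝ)⁻¹ • (a + b + c) := by module
    have ha : (3 : ℝ)⁻¹ • (b - a + (c - a)) = -(a - (3 : ℝ)⁻¹ • (a + b + c)) := by module
    rw [hx, ha, norm_neg]

end
end
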